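/- arXiv:math/0506411 — 2 statements merged into one kernel-verified Lean document; each statement's English description precedes it below -/
import Mathlib

section
/- Let Q ∈ L²_loc(ℝ; ℝ) be real-valued and set q = Q' (a distribution in H⁻¹_loc(ℝ)). Then the following three statements are equivalent: (i) there exists a real-valued r ∈ L²_loc(ℝ) and a constant C ∈ ℝ such that r(x) + ∫₀ˣ r(s)² ds = Q(x) + C for almost every x ∈ ℝ (i.e. q = r' + r² in the sense of distributions); (ii) there exists a solution y of L_q y = 0 (in the system sense) with y(x) > 0 for every x ∈ ℝ; (iii) L_q ≥ 0, i.e. for every φ ∈ C_c^∞(ℝ; ℝ) one has ∫ φ'(x)² dx − 2∫ Q(x) φ(x) φ'(x) dx ≥ 0. -/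
open MeasureTheory Filter Set intervalIntegral ENNReal

/-- `Q : ℝ → ℝ` is (real-valued and) locally square integrable on `ℝ`. -/
def LocL2 (Q : ℝ → ℝ) : Prop :=
  Measurable Q ∧ ∀ a b : ℝ, IntegrableOn (fun x => Q x ^ 2) (Set.Icc a b) volume

/-- `y` together with the companion function `u` (representing `u = y' - Q·y`) solves the
first-order system `y' = Q y + u`, `u' = -Q² y - Q u` equivalent to `L_q y = 0` with `q = Q'`,
expressed through integral equations (encoding local absolute continuity). -/
def SolvesWith (Q y u : ℝ → ℝ) : Prop :=
  (∀ x : ℝ, y x = y 0 + ∫ t in (0:ℝ)..x, (Q t * y t + u t)) ∧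
  (∀ x : ℝ, u x = u 0 + ∫ t in (0:ℝ)..x, (-(Q t) ^ 2 * y t - Q t * u t))

/-- `y` solves `L_q y = 0` on `ℝ` in the system sense, `q = Q'`. -/
def Solves (Q y : ℝ → ℝ) : Prop := ∃ u : ℝ → ℝ, SolvesWith Q y u

/-- `L_q ≥ 0` for `q = Q'`: for every real-valued test function `φ`,
`∫ φ'² dx - 2 ∫ Q φ φ' dx ≥ 0` (the second term is the pairing `(q, φ²)`). -/
def LqNonneg (Q : ℝ → ℝ) : Prop :=
  ∀ φ : ℝ → ℝ, ContDiff ℝ (⊤ : ℕ∞) φ → HasCompactSupport φ →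
    0 ≤ (∫ x : ℝ, deriv φ x ^ 2) - 2 * ∫ x : ℝ, Q x * φ x * deriv φ x

/-- The Riccati relation `q = B(r) = r' + r²` for `q = Q'`: there is a constant `C` with
`r x + ∫₀ˣ r² = Q x + C` for almost every `x`. -/
def Riccati (Q r : ℝ → ℝ) : Prop :=
  ∃ C : ℝ, ∀ᵐ x : ℝ ∂volume, r x + (∫ s in (0:ℝ)..x, r s ^ 2) = Q x + C

/-- `F` is absolutely continuous on the interval between `a` and `b`, with almost everywhere
derivative `f`. -/
def HasACDeriv (F f : ℝ → ℝ) (a b : ℝ) : Prop :=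
  AbsolutelyContinuousOnInterval F a b ∧ ∀ᵐ x : ℝ, x ∈ uIcc a b → HasDerivAt F (f x) x

namespace HasACDeriv

variable {F G f g : ℝ → ℝ} {a b c d : ℝ}

theorem mono (h : HasACDeriv F f a b) (hcd : uIcc c d ⊆ uIcc a b) : HasACDeriv F f c d :=
  ⟨h.1.mono hcd, h.2.mono fun _ hx hxm => hx (hcd hxm)⟩

theorem congr_deriv (h : HasACDeriv F f a b) (hfg : ∀ᵐ x, f x = g x) : HasACDeriv F g a b := by
  refine ⟨h.1, ?_⟩
  filter_upwards [h.2, hfg] with x hx hfx hxm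
  exact hfx ▸ hx hxm

theorem continuousOn (h : HasACDeriv F f a b) : ContinuousOn F (uIcc a b) :=
  h.1.continuousOn

theorem intervalIntegrable (h : HasACDeriv F f a b) : IntervalIntegrable f volume a b := by
  refine h.1.intervalIntegrable_deriv.congr_ae ?_
  rw [Filter.EventuallyEq, ae_restrict_iff' measurableSet_uIoc]
  filter_upwards [h.2] with x hx hxm
  exact (hx (uIoc_subset_uIcc hxm)).deriv

theorem integral_eq_sub (h : HasACDeriv F f a b) : ∫ x in a..b, f x = F b - F a := by
  rw [← h.1.integral_deriv_eq_sub]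
  refine integral_congr_ae ?_
  filter_upwards [h.2] with x hx hxm
  exact (hx (uIoc_subset_uIcc hxm)).deriv.symm

theorem add (hF : HasACDeriv F f a b) (hG : HasACDeriv G g a b) :
    HasACDeriv (fun x => F x + G x) (fun x => f x + g x) a b := by
  refine ⟨hF.1.fun_add hG.1, ?_⟩
  filter_upwards [hF.2, hG.2] with x hx hx' hxm
  exact (hx hxm).add (hx' hxm)

theorem neg (hF : HasACDeriv F f a b) : HasACDeriv (fun x => -F x) (fun x => -f x) a b := by
  refine ⟨hF.1.fun_neg, ?_⟩
  filter_upwards [hF.2] with x hx hxm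
  exact (hx hxm).neg

theorem sub (hF : HasACDeriv F f a b) (hG : HasACDeriv G g a b) :
    HasACDeriv (fun x => F x - G x) (fun x => f x - g x) a b := by
  refine ⟨hF.1.fun_sub hG.1, ?_⟩
  filter_upwards [hF.2, hG.2] with x hx hx' hxm
  exact (hx hxm).sub (hx' hxm)

theorem mul (hF : HasACDeriv F f a b) (hG : HasACDeriv G g a b) :
    HasACDeriv (fun x => F x * G x) (fun x => f x * G x + F x * g x) a b := by
  refine ⟨hF.1.fun_mul hG.1, ?_⟩
  filter_upwards [hF.2, hG.2] with x hx hx' hxm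
  exact (hx hxm).mul (hx' hxm)

theorem const (c : ℝ) : HasACDeriv (fun _ => c) (fun _ => 0) a b := by
  refine ⟨LipschitzOnWith.absolutelyContinuousOnInterval (K := 0) ?_, ?_⟩
  · exact (LipschitzWith.const c).lipschitzOnWith
  · exact ae_of_all _ fun x _ => hasDerivAt_const x c

theorem const_mul (c : ℝ) (hF : HasACDeriv F f a b) :
    HasACDeriv (fun x => c * F x) (fun x => c * f x) a b := by
  refine ⟨hF.1.const_mul c, ?_⟩
  filter_upwards [hF.2] with x hx hxm
  exact (hx hxm).const_mul c

theorem of_contDiff (hF : ContDiff ℝ 1 F) : HasACDeriv F (deriv F) a b :=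
  ⟨hF.contDiffOn.absolutelyContinuousOnInterval, ae_of_all _ fun x _ =>
    (hF.differentiable one_ne_zero x).hasDerivAt⟩

theorem of_integral (hf : IntervalIntegrable f volume a b) (hc : c ∈ uIcc a b) (C : ℝ)
    (hF : ∀ x, F x = C + ∫ t in c..x, f t) : HasACDeriv F f a b := by
  obtain rfl : F = fun x => C + ∫ t in c..x, f t := funext hF
  refine ⟨(const C).1.fun_add (hf.absolutelyContinuousOnInterval_intervalIntegral hc), ?_⟩
  filter_upwards [hf.ae_hasDerivAt_integral] with x hx hxm
  exact (hx hxm c hc).const_add C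

/-- The chain rule for an outer function that is `C¹` on an open set. -/
theorem comp {Φ φ : ℝ → ℝ} {U : Set ℝ} (hF : HasACDeriv F f a b) (hΦ : ContDiffOn ℝ 1 Φ U)
    (hFU : ∀ x, F x ∈ U) (hφ : ∀ x ∈ U, HasDerivAt Φ (φ x) x) :
    HasACDeriv (fun x => Φ (F x)) (fun x => φ (F x) * f x) a b := by
  constructor
  · have hconv : Convex ℝ (F '' uIcc a b) :=
      ((isPreconnected_uIcc.image F hF.continuousOn)).ordConnected.convex
    have hsub : F '' uIcc a b ⊆ U := by
      rintro _ ⟨x, -, rfl⟩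
      exact hFU x
    obtain ⟨K, hK⟩ := LocallyLipschitzOn.exists_lipschitzOnWith_of_compact
      (isCompact_uIcc.image_of_continuousOn hF.continuousOn)
      ((hΦ.mono hsub).locallyLipschitzOn hconv)
    have hAC := (absolutelyContinuousOnInterval_iff F a b).1 hF.1
    rw [absolutelyContinuousOnInterval_iff]
    intro ε hε
    obtain ⟨δ, hδ, h⟩ := hAC (ε / (K + 1)) (by positivity)
    refine ⟨δ, hδ, fun E hE hEδ => ?_⟩
    have h1 := h E hE hEδ
    have h2 : ∑ i ∈ Finset.range E.1, dist (Φ (F (E.2 i).1)) (Φ (F (E.2 i).2)) ≤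
        K * ∑ i ∈ Finset.range E.1, dist (F (E.2 i).1) (F (E.2 i).2) := by
      rw [Finset.mul_sum]
      refine Finset.sum_le_sum fun i hi => ?_
      exact hK.dist_le_mul _ (mem_image_of_mem F (hE.1 i hi).1) _
        (mem_image_of_mem F (hE.1 i hi).2)
    rw [lt_div_iff₀ (by positivity)] at h1
    have h3 : 0 ≤ ∑ i ∈ Finset.range E.1, dist (F (E.2 i).1) (F (E.2 i).2) :=
      Finset.sum_nonneg fun _ _ => dist_nonneg
    nlinarith
  · filter_upwards [hF.2] with x hx hxm
    exact (hφ _ (hFU x)).comp x (hx hxm)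

end HasACDeriv

namespace LocL2

variable {Q : ℝ → ℝ}

theorem intervalIntegrable_sq (hQ : LocL2 Q) (a b : ℝ) :
    IntervalIntegrable (fun x => Q x ^ 2) volume a b :=
  intervalIntegrable_iff.2 ((hQ.2 (min a b) (max a b)).mono_set Ioc_subset_Icc_self)

theorem intervalIntegrable (hQ : LocL2 Q) (a b : ℝ) : IntervalIntegrable Q volume a b := by
  refine ((intervalIntegrable_const (c := (1 : ℝ))).add
    (hQ.intervalIntegrable_sq a b)).mono_fun hQ.1.aestronglyMeasurable ?_
  refine ae_of_all _ fun x => ?_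
  simp only [Real.norm_eq_abs]
  refine le_trans ?_ (le_abs_self _)
  nlinarith [sq_abs (Q x), sq_nonneg (|Q x| - 1)]

end LocL2

section InitialValueProblem

variable {Q : ℝ → ℝ}

/-- A locally integrable bound for the coefficients of the first-order system. -/
noncomputable def coeffBound (Q : ℝ → ℝ) (x : ℝ) : ℝ := (1 + |Q x|) ^ 2

/-- A weight turning the integral operator of the first-order system into a contraction. -/
noncomputable def picardWeight (Q : ℝ → ℝ) (x : ℝ) : ℝ :=
  Real.cosh (2 * ∫ t in (0:ℝ)..x, coeffBound Q t)

theorem one_le_picardWeight (x : ℝ) : 1 ≤ picardWeight Q x := Real.one_le_cosh _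

theorem picardWeight_pos (x : ℝ) : 0 < picardWeight Q x := Real.cosh_pos _

theorem intervalIntegrable_coeffBound (hQ : LocL2 Q) (a b : ℝ) :
    IntervalIntegrable (coeffBound Q) volume a b := by
  have h := (intervalIntegrable_const (c := (1 : ℝ)) (a := a) (b := b) (μ := volume)).add
    (((hQ.intervalIntegrable a b).abs.const_mul 2).add (hQ.intervalIntegrable_sq a b))
  refine h.congr_ae (ae_of_all _ fun x => ?_)
  simp only [coeffBound]
  nlinarith [sq_abs (Q x)]

theorem hasACDeriv_two_mul_integral_coeffBound (hQ : LocL2 Q) (x : ℝ) :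
    HasACDeriv (fun x => 2 * ∫ t in (0:ℝ)..x, coeffBound Q t) (fun x => 2 * coeffBound Q x) 0 x :=
  (HasACDeriv.of_integral (intervalIntegrable_coeffBound hQ 0 x) left_mem_uIcc 0
    fun _ => (zero_add _).symm).const_mul 2

theorem continuous_picardWeight (hQ : LocL2 Q) : Continuous (picardWeight Q) :=
  Real.continuous_cosh.comp (continuous_const.mul
    (continuous_primitive (intervalIntegrable_coeffBound hQ) 0))

theorem integral_picardWeight_mul_coeffBound (hQ : LocL2 Q) (x : ℝ) :
    ∫ t in (0:ℝ)..x, picardWeight Q t * coeffBound Q t =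
      Real.sinh (2 * ∫ t in (0:ℝ)..x, coeffBound Q t) / 2 := by
  have h := ((hasACDeriv_two_mul_integral_coeffBound hQ x).comp (U := univ)
    Real.contDiff_sinh.contDiffOn (fun _ => mem_univ _)
    (fun y _ => Real.hasDerivAt_sinh y)).integral_eq_sub
  have h' : ∫ t in (0:ℝ)..x, picardWeight Q t * coeffBound Q t =
      (∫ t in (0:ℝ)..x, Real.cosh (2 * ∫ s in (0:ℝ)..t, coeffBound Q s) *
        (2 * coeffBound Q t)) / 2 := by
    rw [← intervalIntegral.integral_div]
    refine integral_congr fun t _ => ?_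
    simp only [picardWeight]
    ring
  rw [h', h]
  simp

theorem abs_integral_picardWeight_mul_le (hQ : LocL2 Q) {h : ℝ → ℝ} {C : ℝ} (hC : 0 ≤ C)
    (hh : ∀ t, |h t| ≤ coeffBound Q t * C) (x : ℝ) :
    |∫ t in (0:ℝ)..x, picardWeight Q t * h t| ≤ C / 2 * picardWeight Q x := by
  have hint : IntervalIntegrable (fun t => C * (picardWeight Q t * coeffBound Q t)) volume 0 x :=
    ((intervalIntegrable_coeffBound hQ 0 x).continuousOn_mul
      (continuous_picardWeight hQ).continuousOn).const_mul C
  have h1 := norm_integral_le_abs_of_norm_le (f := fun t => picardWeight Q t * h t)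
    (ae_of_all _ fun t => by
      rw [Real.norm_eq_abs, abs_mul, abs_of_pos (picardWeight_pos t)]
      calc picardWeight Q t * |h t| ≤ picardWeight Q t * (coeffBound Q t * C) :=
            mul_le_mul_of_nonneg_left (hh t) (picardWeight_pos t).le
        _ = C * (picardWeight Q t * coeffBound Q t) := by ring) hint
  refine h1.trans ?_
  rw [intervalIntegral.integral_const_mul, integral_picardWeight_mul_coeffBound hQ, abs_mul,
    abs_of_nonneg hC, abs_div, abs_two, picardWeight]
  have : |Real.sinh (2 * ∫ t in (0:ℝ)..x, coeffBound Q t)| ≤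
      Real.cosh (2 * ∫ t in (0:ℝ)..x, coeffBound Q t) := by
    rw [abs_le]
    constructor
    · linarith [Real.cosh_add_sinh (2 * ∫ t in (0:ℝ)..x, coeffBound Q t),
        Real.exp_pos (2 * ∫ t in (0:ℝ)..x, coeffBound Q t)]
    · exact (Real.sinh_lt_cosh _).le
  calc C * (|Real.sinh (2 * ∫ t in (0:ℝ)..x, coeffBound Q t)| / 2)
      = C / 2 * |Real.sinh (2 * ∫ t in (0:ℝ)..x, coeffBound Q t)| := by ring
    _ ≤ _ := mul_le_mul_of_nonneg_left this (by positivity)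

theorem intervalIntegrable_picardWeight_mul (hQ : LocL2 Q) {h : ℝ → ℝ} {C : ℝ}
    (hm : Measurable h) (hh : ∀ t, |h t| ≤ coeffBound Q t * C) (a b : ℝ) :
    IntervalIntegrable (fun t => picardWeight Q t * h t) volume a b := by
  refine IntervalIntegrable.continuousOn_mul ?_ (continuous_picardWeight hQ).continuousOn
  refine ((intervalIntegrable_coeffBound hQ a b).mul_const C).mono_fun
    hm.aestronglyMeasurable (ae_of_all _ fun x => ?_)
  exact (hh x).trans (le_abs_self _)

/-- One scalar component of the weighted Picard operator. -/
noncomputable def weightedPrimitive (Q : ℝ → ℝ) (c : ℝ) (h : ℝ → ℝ) (x : ℝ) : ℝ :=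
  (c + ∫ t in (0:ℝ)..x, picardWeight Q t * h t) / picardWeight Q x

theorem continuous_weightedPrimitive (hQ : LocL2 Q) (c : ℝ) {h : ℝ → ℝ} {C : ℝ}
    (hm : Measurable h) (hh : ∀ t, |h t| ≤ coeffBound Q t * C) :
    Continuous (weightedPrimitive Q c h) :=
  (continuous_const.add (continuous_primitive
    (intervalIntegrable_picardWeight_mul hQ hm hh) 0)).div (continuous_picardWeight hQ)
    fun x => (picardWeight_pos x).ne'

theorem abs_weightedPrimitive_le (hQ : LocL2 Q) (c : ℝ) {h : ℝ → ℝ} {C : ℝ} (hC : 0 ≤ C)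
    (hh : ∀ t, |h t| ≤ coeffBound Q t * C) (x : ℝ) :
    |weightedPrimitive Q c h x| ≤ |c| + C / 2 := by
  rw [weightedPrimitive, abs_div, abs_of_pos (picardWeight_pos x), div_le_iff₀ (picardWeight_pos x)]
  calc |c + ∫ t in (0:ℝ)..x, picardWeight Q t * h t|
      ≤ |c| + |∫ t in (0:ℝ)..x, picardWeight Q t * h t| := abs_add_le _ _
    _ ≤ |c| * picardWeight Q x + C / 2 * picardWeight Q x :=
        add_le_add (le_mul_of_one_le_right (abs_nonneg c) (one_le_picardWeight x))
          (abs_integral_picardWeight_mul_le hQ hC hh x)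
    _ = (|c| + C / 2) * picardWeight Q x := by ring

theorem abs_weightedPrimitive_sub_le (hQ : LocL2 Q) (c : ℝ) {h₁ h₂ : ℝ → ℝ} {C₁ C₂ C : ℝ}
    (hm₁ : Measurable h₁) (hh₁ : ∀ t, |h₁ t| ≤ coeffBound Q t * C₁)
    (hm₂ : Measurable h₂) (hh₂ : ∀ t, |h₂ t| ≤ coeffBound Q t * C₂) (hC : 0 ≤ C)
    (hh : ∀ t, |h₁ t - h₂ t| ≤ coeffBound Q t * C) (x : ℝ) :
    |weightedPrimitive Q c h₁ x - weightedPrimitive Q c h₂ x| ≤ C / 2 := by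
  have key : weightedPrimitive Q c h₁ x - weightedPrimitive Q c h₂ x =
      weightedPrimitive Q 0 (fun t => h₁ t - h₂ t) x := by
    simp only [weightedPrimitive, mul_sub]
    rw [intervalIntegral.integral_sub (intervalIntegrable_picardWeight_mul hQ hm₁ hh₁ 0 x)
      (intervalIntegrable_picardWeight_mul hQ hm₂ hh₂ 0 x)]
    ring
  rw [key]
  simpa using abs_weightedPrimitive_le hQ 0 hC hh x

theorem abs_fst_coeff_le {p q C : ℝ} (hp : |p| ≤ C) (hq : |q| ≤ C) (t : ℝ) :
    |Q t * p + q| ≤ coeffBound Q t * C := by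
  have hC : 0 ≤ C := (abs_nonneg p).trans hp
  calc |Q t * p + q| ≤ |Q t| * |p| + |q| := (abs_add_le _ _).trans_eq (by rw [abs_mul])
    _ ≤ |Q t| * C + C := add_le_add (mul_le_mul_of_nonneg_left hp (abs_nonneg _)) hq
    _ ≤ coeffBound Q t * C := by
        have : 0 ≤ (|Q t| + |Q t| ^ 2) * C := by positivity
        simp only [coeffBound]
        nlinarith

theorem abs_snd_coeff_le {p q C : ℝ} (hp : |p| ≤ C) (hq : |q| ≤ C) (t : ℝ) :
    |-(Q t) ^ 2 * p - Q t * q| ≤ coeffBound Q t * C := by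
  have hC : 0 ≤ C := (abs_nonneg p).trans hp
  have h : -(Q t) ^ 2 * p - Q t * q = -(Q t * (Q t * p + q)) := by ring
  rw [h, abs_neg, abs_mul]
  calc |Q t| * |Q t * p + q| ≤ |Q t| * (|Q t| * C + C) := by
        refine mul_le_mul_of_nonneg_left ?_ (abs_nonneg _)
        refine (abs_add_le _ _).trans ?_
        rw [abs_mul]
        exact add_le_add (mul_le_mul_of_nonneg_left hp (abs_nonneg _)) hq
    _ ≤ coeffBound Q t * C := by
        have : 0 ≤ (|Q t| + 1) * C := by positivity
        simp only [coeffBound]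
        nlinarith

open BoundedContinuousFunction in
/-- The first-order system has a global solution with prescribed initial values. -/
theorem exists_solvesWith (hQ : LocL2 Q) (α β : ℝ) :
    ∃ y u : ℝ → ℝ, Continuous y ∧ Continuous u ∧ SolvesWith Q y u ∧ y 0 = α ∧ u 0 = β := by
  have hfst : ∀ (f : ℝ →ᵇ ℝ × ℝ) t, |(f t).1| ≤ ‖f‖ := fun f t =>
    (norm_fst_le (f t)).trans (f.norm_coe_le_norm t)
  have hsnd : ∀ (f : ℝ →ᵇ ℝ × ℝ) t, |(f t).2| ≤ ‖f‖ := fun f t =>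
    (norm_snd_le (f t)).trans (f.norm_coe_le_norm t)
  let A : (ℝ →ᵇ ℝ × ℝ) → ℝ → ℝ := fun f t => Q t * (f t).1 + (f t).2
  let B : (ℝ →ᵇ ℝ × ℝ) → ℝ → ℝ := fun f t => -(Q t) ^ 2 * (f t).1 - Q t * (f t).2
  have hmA : ∀ f, Measurable (A f) := fun f =>
    (hQ.1.mul f.continuous.fst.measurable).add f.continuous.snd.measurable
  have hmB : ∀ f, Measurable (B f) := fun f =>
    ((hQ.1.pow_const 2).neg.mul f.continuous.fst.measurable).sub
      (hQ.1.mul f.continuous.snd.measurable)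
  have hA : ∀ f t, |A f t| ≤ coeffBound Q t * ‖f‖ := fun f t =>
    abs_fst_coeff_le (hfst f t) (hsnd f t) t
  have hB : ∀ f t, |B f t| ≤ coeffBound Q t * ‖f‖ := fun f t =>
    abs_snd_coeff_le (hfst f t) (hsnd f t) t
  let T : (ℝ →ᵇ ℝ × ℝ) → (ℝ →ᵇ ℝ × ℝ) := fun f =>
    BoundedContinuousFunction.ofNormedAddCommGroup
      (fun x => (weightedPrimitive Q α (A f) x, weightedPrimitive Q β (B f) x))
      ((continuous_weightedPrimitive hQ α (hmA f) (hA f)).prodMk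
        (continuous_weightedPrimitive hQ β (hmB f) (hB f)))
      (max (|α| + ‖f‖ / 2) (|β| + ‖f‖ / 2))
      (fun x => max_le_max (abs_weightedPrimitive_le hQ α (norm_nonneg f) (hA f) x)
        (abs_weightedPrimitive_le hQ β (norm_nonneg f) (hB f) x))
  have hT : ContractingWith (1 / 2) T := by
    refine ⟨by rw [← NNReal.coe_lt_coe]; norm_num, LipschitzWith.of_dist_le_mul fun f g => ?_⟩
    have hfg : (((1 / 2 : NNReal)) : ℝ) * dist f g = ‖f - g‖ / 2 := by
      rw [dist_eq_norm]; push_cast; ring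
    rw [hfg, BoundedContinuousFunction.dist_le (by positivity)]
    intro x
    have hAfg : ∀ t, |A f t - A g t| ≤ coeffBound Q t * ‖f - g‖ := fun t => by
      have := abs_fst_coeff_le (Q := Q) (hfst (f - g) t) (hsnd (f - g) t) t
      convert this using 2
      simp only [A, BoundedContinuousFunction.coe_sub, Pi.sub_apply, Prod.fst_sub, Prod.snd_sub]
      ring
    have hBfg : ∀ t, |B f t - B g t| ≤ coeffBound Q t * ‖f - g‖ := fun t => by
      have := abs_snd_coeff_le (Q := Q) (hfst (f - g) t) (hsnd (f - g) t) t
      convert this using 2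
      simp only [B, BoundedContinuousFunction.coe_sub, Pi.sub_apply, Prod.fst_sub, Prod.snd_sub]
      ring
    exact max_le
      (abs_weightedPrimitive_sub_le hQ α (hmA f) (hA f) (hmA g) (hA g) (norm_nonneg _) hAfg x)
      (abs_weightedPrimitive_sub_le hQ β (hmB f) (hB f) (hmB g) (hB g) (norm_nonneg _) hBfg x)
  let f := ContractingWith.fixedPoint T hT
  have hf : T f = f := hT.fixedPoint_isFixedPt
  have hw : ∀ x, picardWeight Q x ≠ 0 := fun x => (picardWeight_pos x).ne'
  have h1 : ∀ x, picardWeight Q x * (f x).1 =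
      α + ∫ t in (0:ℝ)..x, (Q t * (picardWeight Q t * (f t).1) + picardWeight Q t * (f t).2) := by
    intro x
    have : (f x).1 = weightedPrimitive Q α (A f) x :=
      (congrArg (fun g : ℝ →ᵇ ℝ × ℝ => (g x).1) hf).symm
    rw [this, weightedPrimitive, mul_div_cancel₀ _ (hw x)]
    congr 1
    refine integral_congr fun t _ => ?_
    simp only [A]
    ring
  have h2 : ∀ x, picardWeight Q x * (f x).2 =
      β + ∫ t in (0:ℝ)..x, (-(Q t) ^ 2 * (picardWeight Q t * (f t).1) -
        Q t * (picardWeight Q t * (f t).2)) := by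
    intro x
    have : (f x).2 = weightedPrimitive Q β (B f) x :=
      (congrArg (fun g : ℝ →ᵇ ℝ × ℝ => (g x).2) hf).symm
    rw [this, weightedPrimitive, mul_div_cancel₀ _ (hw x)]
    congr 1
    refine integral_congr fun t _ => ?_
    simp only [B]
    ring
  have h1' : picardWeight Q 0 * (f 0).1 = α := by simpa using h1 0
  have h2' : picardWeight Q 0 * (f 0).2 = β := by simpa using h2 0
  refine ⟨fun x => picardWeight Q x * (f x).1, fun x => picardWeight Q x * (f x).2,
    (continuous_picardWeight hQ).mul f.continuous.fst,
    (continuous_picardWeight hQ).mul f.continuous.snd, ⟨fun x => ?_, fun x => ?_⟩, h1', h2'⟩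
  · simp only [h1']
    exact h1 x
  · simp only [h2']
    exact h2 x

end InitialValueProblem

section Regularity

variable {Q y u y₁ u₁ y₂ u₂ : ℝ → ℝ}

theorem SolvesWith.hasACDeriv_fst (h : SolvesWith Q y u) {x : ℝ}
    (hint : IntervalIntegrable (fun t => Q t * y t + u t) volume 0 x) :
    HasACDeriv y (fun t => Q t * y t + u t) 0 x :=
  HasACDeriv.of_integral hint left_mem_uIcc _ h.1

theorem SolvesWith.hasACDeriv_snd (h : SolvesWith Q y u) {x : ℝ}
    (hint : IntervalIntegrable (fun t => -(Q t) ^ 2 * y t - Q t * u t) volume 0 x) :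
    HasACDeriv u (fun t => -(Q t) ^ 2 * y t - Q t * u t) 0 x :=
  HasACDeriv.of_integral hint left_mem_uIcc _ h.2

/-- The Wronskian of two solutions of the first-order system is constant. -/
theorem wronskian_eq {a b : ℝ} (hy₁ : HasACDeriv y₁ (fun t => Q t * y₁ t + u₁ t) a b)
    (hu₁ : HasACDeriv u₁ (fun t => -(Q t) ^ 2 * y₁ t - Q t * u₁ t) a b)
    (hy₂ : HasACDeriv y₂ (fun t => Q t * y₂ t + u₂ t) a b)
    (hu₂ : HasACDeriv u₂ (fun t => -(Q t) ^ 2 * y₂ t - Q t * u₂ t) a b) :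
    y₁ b * u₂ b - u₁ b * y₂ b = y₁ a * u₂ a - u₁ a * y₂ a := by
  have h := ((hy₁.mul hu₂).sub (hu₁.mul hy₂)).integral_eq_sub
  have h0 : ∫ x in a..b, ((Q x * y₁ x + u₁ x) * u₂ x + y₁ x * (-(Q x) ^ 2 * y₂ x - Q x * u₂ x) -
      ((-(Q x) ^ 2 * y₁ x - Q x * u₁ x) * y₂ x + u₁ x * (Q x * y₂ x + u₂ x))) = 0 := by
    rw [← intervalIntegral.integral_zero (a := a) (b := b) (μ := volume)]
    exact integral_congr fun x _ => by ring
  linarith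

theorem intervalIntegrable_coeff_mul (hQ : LocL2 Q) {a b C : ℝ} (hmy : Measurable y)
    (hmu : Measurable u) (hy : ∀ x ∈ uIcc a b, |y x| ≤ C) (hu : ∀ x ∈ uIcc a b, |u x| ≤ C) :
    IntervalIntegrable (fun t => Q t * y t + u t) volume a b ∧
      IntervalIntegrable (fun t => -(Q t) ^ 2 * y t - Q t * u t) volume a b := by
  have hb := (intervalIntegrable_coeffBound hQ a b).mul_const C
  constructor
  · refine hb.mono_fun ((hQ.1.mul hmy).add hmu).aestronglyMeasurable ?_
    refine (ae_restrict_iff' measurableSet_uIoc).2 (ae_of_all _ fun t ht => ?_)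
    exact (abs_fst_coeff_le (hy t (uIoc_subset_uIcc ht)) (hu t (uIoc_subset_uIcc ht)) t).trans
      (le_abs_self _)
  · refine hb.mono_fun (((hQ.1.pow_const 2).neg.mul hmy).sub
      (hQ.1.mul hmu)).aestronglyMeasurable ?_
    refine (ae_restrict_iff' measurableSet_uIoc).2 (ae_of_all _ fun t ht => ?_)
    exact (abs_snd_coeff_le (hy t (uIoc_subset_uIcc ht)) (hu t (uIoc_subset_uIcc ht)) t).trans
      (le_abs_self _)

theorem intervalIntegrable_coeff_of_continuous (hQ : LocL2 Q) (hy : Continuous y)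
    (hu : Continuous u) (a b : ℝ) :
    IntervalIntegrable (fun t => Q t * y t + u t) volume a b ∧
      IntervalIntegrable (fun t => -(Q t) ^ 2 * y t - Q t * u t) volume a b := by
  obtain ⟨C, hC⟩ := (isCompact_uIcc (a := a) (b := b)).exists_bound_of_continuousOn hy.continuousOn
  obtain ⟨D, hD⟩ := (isCompact_uIcc (a := a) (b := b)).exists_bound_of_continuousOn hu.continuousOn
  exact intervalIntegrable_coeff_mul hQ (C := max C D) hy.measurable hu.measurable
    (fun x hx => (hC x hx).trans (le_max_left _ _)) (fun x hx => (hD x hx).trans (le_max_right _ _))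

theorem SolvesWith.hasACDeriv (hQ : LocL2 Q) (h : SolvesWith Q y u) (hy : Continuous y)
    (hu : Continuous u) (a b : ℝ) :
    HasACDeriv y (fun t => Q t * y t + u t) a b ∧
      HasACDeriv u (fun t => -(Q t) ^ 2 * y t - Q t * u t) a b := by
  have hsub : uIcc a b ⊆ uIcc (min 0 (min a b)) (max 0 (max a b)) := by
    rw [uIcc_of_le (by grind : min 0 (min a b) ≤ max 0 (max a b))]
    intro x hx
    rw [mem_uIcc] at hx
    rw [mem_Icc]
    grind
  have h0 : (0 : ℝ) ∈ uIcc (min 0 (min a b)) (max 0 (max a b)) := by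
    rw [mem_uIcc]
    grind
  have hint := intervalIntegrable_coeff_of_continuous hQ hy hu
    (min 0 (min a b)) (max 0 (max a b))
  exact ⟨(HasACDeriv.of_integral hint.1 h0 _ h.1).mono hsub,
    (HasACDeriv.of_integral hint.2 h0 _ h.2).mono hsub⟩

/-- The set on which a primitive based at `0` is not given by a junk value. -/
def integrableRange (g : ℝ → ℝ) : Set ℝ := {x | IntervalIntegrable g volume 0 x}

theorem zero_mem_integrableRange (g : ℝ → ℝ) : (0 : ℝ) ∈ integrableRange g :=
  IntervalIntegrable.refl

theorem mem_integrableRange_of_mem_uIcc {g : ℝ → ℝ} {x s : ℝ} (hs : s ∈ integrableRange g)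
    (hx : x ∈ uIcc 0 s) : x ∈ integrableRange g :=
  IntervalIntegrable.mono_set hs (uIcc_subset_uIcc_left hx)

theorem ordConnected_integrableRange (g : ℝ → ℝ) : (integrableRange g).OrdConnected := by
  refine ⟨fun x hx z hz w hw => ?_⟩
  rcases le_total 0 w with h | h
  · exact mem_integrableRange_of_mem_uIcc hz (mem_uIcc.2 (Or.inl ⟨h, hw.2⟩))
  · exact mem_integrableRange_of_mem_uIcc hx (mem_uIcc.2 (Or.inr ⟨hw.1, h⟩))

theorem continuousOn_primitive_integrableRange (g : ℝ → ℝ) :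
    ContinuousOn (fun x => ∫ t in (0:ℝ)..x, g t) (integrableRange g) := by
  intro m hm
  have key : ∀ s ∈ integrableRange g,
      ContinuousWithinAt (fun x => ∫ t in (0:ℝ)..x, g t) (uIcc m s) m := by
    intro s hs
    have hms : IntervalIntegrable g volume m s := hm.symm.trans hs
    have h := (continuousOn_primitive_interval' hms left_mem_uIcc) m left_mem_uIcc
    refine ((continuousWithinAt_const (b := ∫ t in (0:ℝ)..m, g t)).add h).congr ?_ ?_
    · intro x hx
      exact (integral_add_adjacent_intervals hm
        (hms.mono_set (uIcc_subset_uIcc_left hx))).symm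
    · simp
  have hunion : integrableRange g ⊆
      (integrableRange g ∩ Ici m) ∪ (integrableRange g ∩ Iic m) := by
    intro x hx
    rcases le_total m x with h | h
    · exact Or.inl ⟨hx, h⟩
    · exact Or.inr ⟨hx, h⟩
  refine ContinuousWithinAt.mono (ContinuousWithinAt.union ?_ ?_) hunion
  · by_cases h : ∃ s ∈ integrableRange g, m < s
    · obtain ⟨s, hs, hms⟩ := h
      have h1 := key s hs
      rw [uIcc_of_le hms.le] at h1
      refine ContinuousWithinAt.mono_of_mem_nhdsWithin h1 ?_
      exact nhdsWithin_mono m inter_subset_right (Icc_mem_nhdsGE hms)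
    · push Not at h
      refine (continuousWithinAt_singleton (x := m)).mono ?_
      exact fun x hx => le_antisymm (h x hx.1) hx.2
  · by_cases h : ∃ s ∈ integrableRange g, s < m
    · obtain ⟨s, hs, hms⟩ := h
      have h1 := key s hs
      rw [uIcc_of_ge hms.le] at h1
      refine ContinuousWithinAt.mono_of_mem_nhdsWithin h1 ?_
      exact nhdsWithin_mono m inter_subset_right (Icc_mem_nhdsLE hms)
    · push Not at h
      refine (continuousWithinAt_singleton (x := m)).mono ?_
      exact fun x hx => le_antisymm hx.2 (h x hx.1)

theorem primitive_eq_zero_of_notMem {g : ℝ → ℝ} {x : ℝ} (hx : x ∉ integrableRange g) :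
    ∫ t in (0:ℝ)..x, g t = 0 :=
  intervalIntegral.integral_undef hx

theorem measurable_primitive (g : ℝ → ℝ) : Measurable fun x => ∫ t in (0:ℝ)..x, g t := by
  classical
  have h := (continuousOn_primitive_integrableRange g).measurable_piecewise
    (continuousOn_const (c := (0 : ℝ))) (ordConnected_integrableRange g).measurableSet
  convert h using 1
  ext x
  by_cases hx : x ∈ integrableRange g
  · simp [hx]
  · simp [hx, primitive_eq_zero_of_notMem]

theorem eventually_abs_primitive_le {g : ℝ → ℝ} {m : ℝ} (hm : m ∈ integrableRange g) :
    ∃ C, ∀ᶠ x in nhds m, |∫ t in (0:ℝ)..x, g t| ≤ C := by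
  have h := (continuousOn_primitive_integrableRange g m hm).abs.eventually_lt_const
    (lt_add_one |∫ t in (0:ℝ)..m, g t|)
  refine ⟨|∫ t in (0:ℝ)..m, g t| + 1, ?_⟩
  filter_upwards [eventually_nhdsWithin_iff.1 h] with x hx
  by_cases hxm : x ∈ integrableRange g
  · exact (hx hxm).le
  · rw [primitive_eq_zero_of_notMem hxm, abs_zero]
    positivity

/-- A solution is a combination of two fundamental solutions wherever the integrals in the
system are meaningful. -/
theorem SolvesWith.eq_combination (hQ : LocL2 Q) (h : SolvesWith Q y u)
    (h₁ : SolvesWith Q y₁ u₁) (h₂ : SolvesWith Q y₂ u₂) (hy₁ : Continuous y₁)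
    (hu₁ : Continuous u₁) (hy₂ : Continuous y₂) (hu₂ : Continuous u₂)
    (hy₁0 : y₁ 0 = 1) (hu₁0 : u₁ 0 = 0) (hy₂0 : y₂ 0 = 0) (hu₂0 : u₂ 0 = 1) {x : ℝ}
    (hx : IntervalIntegrable (fun t => Q t * y t + u t) volume 0 x)
    (hx' : IntervalIntegrable (fun t => -(Q t) ^ 2 * y t - Q t * u t) volume 0 x) :
    y x = y 0 * y₁ x + u 0 * y₂ x ∧ u x = y 0 * u₁ x + u 0 * u₂ x := by
  have hd₁ := h₁.hasACDeriv hQ hy₁ hu₁ 0 x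
  have hd₂ := h₂.hasACDeriv hQ hy₂ hu₂ 0 x
  have e1 := wronskian_eq (h.hasACDeriv_fst hx) (h.hasACDeriv_snd hx') hd₁.1 hd₁.2
  have e2 := wronskian_eq (h.hasACDeriv_fst hx) (h.hasACDeriv_snd hx') hd₂.1 hd₂.2
  have e3 := wronskian_eq hd₁.1 hd₁.2 hd₂.1 hd₂.2
  rw [hy₁0, hu₁0] at e1
  rw [hy₂0, hu₂0] at e2
  rw [hy₁0, hu₁0, hy₂0, hu₂0] at e3
  constructor
  · linear_combination y₁ x * e2 - y₂ x * e1 - y x * e3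
  · linear_combination u₁ x * e2 - u₂ x * e1 - u x * e3

/-- Both components of a solution are continuous; in particular the integrals defining the system
never take junk values. -/
theorem SolvesWith.continuous (hQ : LocL2 Q) (h : SolvesWith Q y u) :
    Continuous y ∧ Continuous u := by
  obtain ⟨y₁, u₁, hy₁, hu₁, h₁, hy₁0, hu₁0⟩ := exists_solvesWith hQ 1 0
  obtain ⟨y₂, u₂, hy₂, hu₂, h₂, hy₂0, hu₂0⟩ := exists_solvesWith hQ 0 1
  set g := fun t => Q t * y t + u t with hg
  set k := fun t => -(Q t) ^ 2 * y t - Q t * u t with hk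
  have hmy : Measurable y := by
    rw [show y = fun x => y 0 + ∫ t in (0:ℝ)..x, g t from funext h.1]
    exact (measurable_primitive g).const_add _
  have hmu : Measurable u := by
    rw [show u = fun x => u 0 + ∫ t in (0:ℝ)..x, k t from funext h.2]
    exact (measurable_primitive k).const_add _
  let S := integrableRange g ∩ integrableRange k
  have hopen : IsOpen S := by
    rw [isOpen_iff_mem_nhds]
    intro m hm
    obtain ⟨C, hC⟩ := eventually_abs_primitive_le hm.1
    obtain ⟨D, hD⟩ := eventually_abs_primitive_le hm.2
    obtain ⟨ε, hε, hball⟩ := Metric.eventually_nhds_iff_ball.1 (hC.and hD)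
    filter_upwards [Metric.ball_mem_nhds m hε] with x hx
    have hsub : uIcc m x ⊆ Metric.ball m ε :=
      (convex_ball m ε).ordConnected.uIcc_subset (Metric.mem_ball_self hε) hx
    have hint := intervalIntegrable_coeff_mul (y := y) (u := u) hQ
      (C := max (|y 0| + C) (|u 0| + D)) (a := m) (b := x) hmy hmu
      (fun z hz => by
        rw [h.1 z]
        exact ((abs_add_le _ _).trans (add_le_add_right (hball z (hsub hz)).1 _)).trans
          (le_max_left _ _))
      (fun z hz => by
        rw [h.2 z]
        exact ((abs_add_le _ _).trans (add_le_add_right (hball z (hsub hz)).2 _)).trans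
          (le_max_right _ _))
    exact ⟨IntervalIntegrable.trans hm.1 hint.1, IntervalIntegrable.trans hm.2 hint.2⟩
  have hclosed : IsClosed S := by
    refine isClosed_of_closure_subset fun m hm => ?_
    have hmem : ∀ x ∈ uIcc 0 m, x ≠ m → x ∈ S := by
      intro x hx hxm
      obtain ⟨s, hs, hsm⟩ := Metric.mem_closure_iff.1 hm (dist m x) (dist_pos.2 hxm.symm)
      rw [Real.dist_eq, Real.dist_eq] at hsm
      have hxs : x ∈ uIcc 0 s := by
        rw [mem_uIcc] at hx ⊢
        grind
      exact ⟨mem_integrableRange_of_mem_uIcc hs.1 hxs, mem_integrableRange_of_mem_uIcc hs.2 hxs⟩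
    have hcomb : ∀ x ∈ uIcc 0 m, x ≠ m →
        y x = y 0 * y₁ x + u 0 * y₂ x ∧ u x = y 0 * u₁ x + u 0 * u₂ x := fun x hx hxm =>
      h.eq_combination hQ h₁ h₂ hy₁ hu₁ hy₂ hu₂ hy₁0 hu₁0 hy₂0 hu₂0
        (hmem x hx hxm).1 (hmem x hx hxm).2
    have hint := intervalIntegrable_coeff_of_continuous hQ
      (y := fun x => y 0 * y₁ x + u 0 * y₂ x) (u := fun x => y 0 * u₁ x + u 0 * u₂ x)
      (by fun_prop) (by fun_prop) 0 m
    have hne : ∀ᵐ x : ℝ, x ≠ m := by simp [ae_iff, measure_singleton]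
    constructor
    · refine hint.1.congr_ae ((ae_restrict_iff' measurableSet_uIoc).2 ?_)
      filter_upwards [hne] with x hx hxm
      obtain ⟨e1, e2⟩ := hcomb x (uIoc_subset_uIcc hxm) hx
      simp only [hg, e1, e2]
    · refine hint.2.congr_ae ((ae_restrict_iff' measurableSet_uIoc).2 ?_)
      filter_upwards [hne] with x hx hxm
      obtain ⟨e1, e2⟩ := hcomb x (uIoc_subset_uIcc hxm) hx
      simp only [hk, e1, e2]
  have huniv : S = univ := IsClopen.eq_univ ⟨hclosed, hopen⟩
    ⟨0, zero_mem_integrableRange g, zero_mem_integrableRange k⟩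
  have hall : ∀ x, y x = y 0 * y₁ x + u 0 * y₂ x ∧ u x = y 0 * u₁ x + u 0 * u₂ x := fun x =>
    have hx : x ∈ S := huniv ▸ mem_univ x
    h.eq_combination hQ h₁ h₂ hy₁ hu₁ hy₂ hu₂ hy₁0 hu₁0 hy₂0 hu₂0 hx.1 hx.2
  constructor
  · rw [funext fun x => (hall x).1]
    fun_prop
  · rw [funext fun x => (hall x).2]
    fun_prop

end Regularity

theorem LocL2.add_continuous {Q w : ℝ → ℝ} (hQ : LocL2 Q) (hw : Continuous w) :
    LocL2 fun x => Q x + w x := by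
  refine ⟨hQ.1.add hw.measurable, fun a b => ?_⟩
  rcases le_or_gt a b with hab | hab
  · rw [← intervalIntegrable_iff_integrableOn_Icc_of_le hab]
    have h := (hQ.intervalIntegrable_sq a b).add
      (((hQ.intervalIntegrable a b).mul_continuousOn
        (g := fun x => 2 * w x) (by fun_prop)).add
      ((hw.pow 2).intervalIntegrable a b))
    refine h.congr_ae (ae_of_all _ fun x => ?_)
    simp only [Pi.pow_apply]
    ring
  · simp [Icc_eq_empty_of_lt hab]

theorem LocL2.hasACDeriv_primitive {r : ℝ → ℝ} (hr : LocL2 r) (C x : ℝ) :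
    HasACDeriv (fun x => C + ∫ t in (0:ℝ)..x, r t) r 0 x :=
  HasACDeriv.of_integral (hr.intervalIntegrable 0 x) left_mem_uIcc C fun _ => rfl

theorem Riccati.exists_pos_solves {Q r : ℝ → ℝ} (hr : LocL2 r) (h : Riccati Q r) :
    ∃ y : ℝ → ℝ, Solves Q y ∧ ∀ x : ℝ, 0 < y x := by
  obtain ⟨C, hC⟩ := h
  let y : ℝ → ℝ := fun x => Real.exp (0 + ∫ t in (0:ℝ)..x, r t)
  let w : ℝ → ℝ := fun x => C - ∫ t in (0:ℝ)..x, r t ^ 2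
  have hy : ∀ x, HasACDeriv y (fun t => y t * r t) 0 x := fun x =>
    (hr.hasACDeriv_primitive 0 x).comp (U := univ) Real.contDiff_exp.contDiffOn
      (fun _ => mem_univ _) (fun z _ => Real.hasDerivAt_exp z)
  have hw : ∀ x, HasACDeriv w (fun t => 0 - r t ^ 2) 0 x := fun x =>
    (HasACDeriv.const C).sub (HasACDeriv.of_integral (hr.intervalIntegrable_sq 0 x)
      left_mem_uIcc 0 fun _ => (zero_add _).symm)
  have hrw : ∀ᵐ x : ℝ, Q x = r x - w x := by
    filter_upwards [hC] with x hx
    simp only [w]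
    linarith
  refine ⟨y, ⟨fun x => w x * y x, fun x => ?_, fun x => ?_⟩, fun x => Real.exp_pos _⟩
  · have hder : HasACDeriv y (fun t => Q t * y t + w t * y t) 0 x := by
      refine (hy x).congr_deriv ?_
      filter_upwards [hrw] with t ht
      rw [ht]
      ring
    rw [hder.integral_eq_sub]
    ring
  · have hder : HasACDeriv (fun x => w x * y x)
        (fun t => -(Q t) ^ 2 * y t - Q t * (w t * y t)) 0 x := by
      refine ((hw x).mul (hy x)).congr_deriv ?_
      filter_upwards [hrw] with t ht
      rw [ht]
      ring
    rw [hder.integral_eq_sub]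
    ring

theorem exists_riccati_of_pos_solves {Q y : ℝ → ℝ} (hQ : LocL2 Q) (hy : Solves Q y)
    (hpos : ∀ x, 0 < y x) : ∃ r : ℝ → ℝ, LocL2 r ∧ Riccati Q r := by
  obtain ⟨u, h⟩ := hy
  obtain ⟨hyc, huc⟩ := h.continuous hQ
  let w : ℝ → ℝ := fun x => u x * (y x)⁻¹
  have hwc : Continuous w := huc.mul (hyc.inv₀ fun x => (hpos x).ne')
  refine ⟨fun x => Q x + w x, hQ.add_continuous hwc, w 0, ae_of_all _ fun x => ?_⟩
  obtain ⟨hdy, hdu⟩ := h.hasACDeriv hQ hyc huc 0 x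
  have hinv : HasACDeriv (fun x => (y x)⁻¹) (fun t => -(y t ^ 2)⁻¹ * (Q t * y t + u t)) 0 x :=
    hdy.comp (U := Ioi 0) (Φ := fun z => z⁻¹) (φ := fun z => -(z ^ 2)⁻¹)
      (contDiffOn_id.inv fun z hz => (ne_of_gt hz)) hpos
      fun z hz => hasDerivAt_inv (ne_of_gt hz)
  have hdw : HasACDeriv (fun t => -w t) (fun t => (Q t + w t) ^ 2) 0 x := by
    refine (hdu.mul hinv).neg.congr_deriv (ae_of_all _ fun t => ?_)
    have := (hpos t).ne'
    simp only [w]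
    field_simp
    ring
  rw [hdw.integral_eq_sub]
  ring

theorem HasCompactSupport.exists_tsupport_subset_Ioo {φ : ℝ → ℝ} (h : HasCompactSupport φ) :
    ∃ R, 0 < R ∧ tsupport φ ⊆ Ioo (-R) R := by
  obtain ⟨R, hR, hsub⟩ := h.isCompact.isBounded.subset_ball_lt 0 0
  refine ⟨R, hR, hsub.trans_eq ?_⟩
  rw [Real.ball_eq_Ioo, zero_sub, zero_add]

/-- The quadratic form of a test function supported in an interval is an integral over it. -/
theorem quadraticForm_eq_intervalIntegral {Q φ : ℝ → ℝ} (hQ : LocL2 Q) (hφ : ContDiff ℝ 1 φ)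
    {a b : ℝ} (hsub : tsupport φ ⊆ Ioo a b) :
    (∫ x : ℝ, deriv φ x ^ 2) - 2 * ∫ x : ℝ, Q x * φ x * deriv φ x =
      ∫ x in a..b, (deriv φ x ^ 2 - 2 * (Q x * φ x * deriv φ x)) := by
  have hd : Continuous (deriv φ) := hφ.continuous_deriv_one
  have hφ0 : ∀ x, x ∉ Ioc a b → φ x = 0 := fun x hx =>
    image_eq_zero_of_notMem_tsupport fun h => hx (Ioo_subset_Ioc_self (hsub h))
  have hd0 : ∀ x, x ∉ Ioc a b → deriv φ x = 0 := fun x hx =>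
    Function.notMem_support.1 fun h =>
      hx (Ioo_subset_Ioc_self (hsub (support_deriv_subset h)))
  have e1 : ∫ x in a..b, deriv φ x ^ 2 = ∫ x : ℝ, deriv φ x ^ 2 :=
    integral_eq_integral_of_support_subset fun x hx => by
      by_contra hx'
      exact hx (by simp [hd0 x hx'])
  have e2 : ∫ x in a..b, Q x * φ x * deriv φ x = ∫ x : ℝ, Q x * φ x * deriv φ x :=
    integral_eq_integral_of_support_subset fun x hx => by
      by_contra hx'
      exact hx (by simp [hd0 x hx'])
  rw [← e1, ← e2, ← intervalIntegral.integral_const_mul, ← intervalIntegral.integral_sub]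
  · exact (hd.pow 2).intervalIntegrable a b
  · exact (((hQ.intervalIntegrable a b).mul_continuousOn
      hφ.continuous.continuousOn).mul_continuousOn hd.continuousOn).const_mul 2

theorem Riccati.lqNonneg {Q r : ℝ → ℝ} (hQ : LocL2 Q) (hr : LocL2 r) (h : Riccati Q r) :
    LqNonneg Q := by
  intro φ hφ hcs
  obtain ⟨C, hC⟩ := h
  have hφ1 : ContDiff ℝ 1 φ := hφ.of_le (by exact_mod_cast le_top)
  have hd : Continuous (deriv φ) := hφ1.continuous_deriv_one
  obtain ⟨R, hR, hsub⟩ := hcs.exists_tsupport_subset_Ioo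
  have hφR : φ R = 0 := image_eq_zero_of_notMem_tsupport fun h => (hsub h).2.false
  have hφR' : φ (-R) = 0 := image_eq_zero_of_notMem_tsupport fun h => (hsub h).1.false
  rw [quadraticForm_eq_intervalIntegral hQ hφ1 hsub]
  have hw : HasACDeriv (fun x => -C + ∫ t in (0:ℝ)..x, r t ^ 2) (fun t => r t ^ 2) (-R) R :=
    HasACDeriv.of_integral (hr.intervalIntegrable_sq (-R) R)
      (mem_uIcc.2 (Or.inl ⟨by linarith, hR.le⟩)) (-C) fun _ => rfl
  have hdφ : HasACDeriv φ (deriv φ) (-R) R := HasACDeriv.of_contDiff hφ1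
  have hprod := hw.mul (hdφ.mul hdφ)
  have h0 := hprod.integral_eq_sub
  simp only [hφR, hφR', mul_zero, sub_zero] at h0
  suffices hs : 0 ≤ (∫ x in (-R)..R, (deriv φ x ^ 2 - 2 * (Q x * φ x * deriv φ x))) +
      ∫ x in (-R)..R, (r x ^ 2 * (φ x * φ x) + (-C + ∫ t in (0:ℝ)..x, r t ^ 2) *
        (deriv φ x * φ x + φ x * deriv φ x)) by
    rwa [h0, add_zero] at hs
  rw [← intervalIntegral.integral_add _ hprod.intervalIntegrable]
  · have e : ∫ x in (-R)..R, (deriv φ x ^ 2 - 2 * (Q x * φ x * deriv φ x) +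
        (r x ^ 2 * (φ x * φ x) + (-C + ∫ t in (0:ℝ)..x, r t ^ 2) *
          (deriv φ x * φ x + φ x * deriv φ x))) =
        ∫ x in (-R)..R, (deriv φ x - r x * φ x) ^ 2 := by
      refine integral_congr_ae ?_
      filter_upwards [hC] with x hx _
      rw [show Q x = r x + (-C + ∫ t in (0:ℝ)..x, r t ^ 2) by linarith]
      ring
    rw [e]
    exact intervalIntegral.integral_nonneg (by linarith) fun x _ => sq_nonneg _
  · exact ((hd.pow 2).intervalIntegrable _ _).sub
      ((((hQ.intervalIntegrable _ _).mul_continuousOn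
        hφ1.continuous.continuousOn).mul_continuousOn hd.continuousOn).const_mul 2)

theorem quadraticForm_integrand_le {δ K N q p ψ d e : ℝ} (hδ : 0 < δ)
    (hp : |p| ≤ N) (he : |e| ≤ K * δ) :
    (ψ + d) ^ 2 - 2 * (q * (p + e) * (ψ + d)) ≤
      (ψ ^ 2 - 2 * (q * p * ψ)) + (δ + K * δ) * ψ ^ 2 + (N * δ + 2 * K * δ) * q ^ 2 +
        (δ⁻¹ + 1 + N * δ⁻¹ + K * δ) * d ^ 2 := by
  have hi : 0 < δ⁻¹ := inv_pos.2 hδ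
  have hid : δ * δ⁻¹ = 1 := mul_inv_cancel₀ hδ.ne'
  have amgm : ∀ s t : ℝ, 2 * |s * t| ≤ δ * s ^ 2 + δ⁻¹ * t ^ 2 := fun s t => by
    rw [abs_mul]
    have h : 0 ≤ δ⁻¹ * (δ * |s| - |t|) ^ 2 := by positivity
    have e : δ⁻¹ * (δ * |s| - |t|) ^ 2 =
        (δ * δ⁻¹) * δ * |s| ^ 2 - 2 * (δ * δ⁻¹) * (|s| * |t|) + δ⁻¹ * |t| ^ 2 := by ring
    rw [e, hid, sq_abs, sq_abs] at h
    linarith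
  have amgm' : ∀ s t : ℝ, 2 * |s * t| ≤ s ^ 2 + t ^ 2 := fun s t => by
    rw [abs_mul, ← sq_abs s, ← sq_abs t]
    nlinarith [sq_nonneg (|s| - |t|)]
  have h1 : 2 * (ψ * d) ≤ δ * ψ ^ 2 + δ⁻¹ * d ^ 2 :=
    (mul_le_mul_of_nonneg_left (le_abs_self _) two_pos.le).trans (amgm ψ d)
  have key : ∀ c s M : ℝ, |c| ≤ M → -(2 * (c * s)) ≤ M * (2 * |s|) := fun c s M hc => by
    have := mul_le_mul_of_nonneg_right hc (abs_nonneg s)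
    rw [← abs_mul] at this
    linarith [neg_abs_le (c * s)]
  have hN : 0 ≤ N := (abs_nonneg p).trans hp
  have hK : 0 ≤ K * δ := (abs_nonneg e).trans he
  have h2 := (key e (q * ψ) _ he).trans (mul_le_mul_of_nonneg_left (amgm' q ψ) hK)
  have h3 := (key e (q * d) _ he).trans (mul_le_mul_of_nonneg_left (amgm' q d) hK)
  have h4 := (key p (q * d) _ hp).trans (mul_le_mul_of_nonneg_left (amgm q d) hN)
  linarith

/-- Nonnegativity of the quadratic form passes to limits of test functions. -/
theorem LqNonneg.integral_nonneg_of_approx {Q φ ψ : ℝ → ℝ} {a b K : ℝ} (hQ : LocL2 Q)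
    (h : LqNonneg Q) (hab : a ≤ b) (hφ : ContinuousOn φ (uIcc a b))
    (hψ : IntervalIntegrable ψ volume a b)
    (hψ2 : IntervalIntegrable (fun x => ψ x ^ 2) volume a b)
    (happ : ∀ δ : ℝ, 0 < δ → δ ≤ 1 → ∃ f : ℝ → ℝ, ContDiff ℝ (⊤ : ℕ∞) f ∧ tsupport f ⊆ Ioo a b ∧
      (∀ x, |f x - φ x| ≤ K * δ) ∧ ∫ x in a..b, (deriv f x - ψ x) ^ 2 ≤ K * δ ^ 2) :
    0 ≤ ∫ x in a..b, (ψ x ^ 2 - 2 * (Q x * φ x * ψ x)) := by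
  obtain ⟨N, hN⟩ := (isCompact_uIcc (a := a) (b := b)).exists_bound_of_continuousOn hφ
  have hN0 : 0 ≤ N := (abs_nonneg _).trans (hN a left_mem_uIcc)
  have hK0 : 0 ≤ K := by
    obtain ⟨f, -, -, hf, -⟩ := happ 1 one_pos le_rfl
    simpa using (abs_nonneg _).trans (hf a)
  set P := ∫ x in a..b, ψ x ^ 2
  set q := ∫ x in a..b, Q x ^ 2
  set F := ∫ x in a..b, (ψ x ^ 2 - 2 * (Q x * φ x * ψ x))
  set M := (1 + K) * P + (N + 2 * K) * q + (2 + N + K) * K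
  have hQψ : IntervalIntegrable (fun x => Q x * φ x * ψ x) volume a b := by
    have hm : IntervalIntegrable (fun x => Q x * ψ x) volume a b := by
      refine ((hQ.intervalIntegrable_sq a b).add hψ2).mono_fun
        (hQ.1.aestronglyMeasurable.mul hψ.aestronglyMeasurable_restrict_uIoc)
        (ae_of_all _ fun x => ?_)
      simp only [Real.norm_eq_abs, abs_mul]
      refine le_trans ?_ (le_abs_self _)
      nlinarith [sq_abs (Q x), sq_abs (ψ x), sq_nonneg (|Q x| - |ψ x|), sq_nonneg (|Q x| + |ψ x|)]
    refine (hm.mul_continuousOn hφ).congr_ae (ae_of_all _ fun x => ?_)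
    ring
  have main : ∀ δ : ℝ, 0 < δ → δ ≤ 1 → 0 ≤ F + M * δ := by
    intro δ hδ hδ1
    obtain ⟨f, hf, hsub, hclose, hd⟩ := happ δ hδ hδ1
    have hf1 : ContDiff ℝ 1 f := hf.of_le (by exact_mod_cast le_top)
    have hdf : Continuous (deriv f) := hf1.continuous_deriv_one
    have h0 := h f hf (HasCompactSupport.of_support_subset_isCompact isCompact_Icc
      ((subset_tsupport f).trans (hsub.trans Ioo_subset_Icc_self)))
    rw [quadraticForm_eq_intervalIntegral hQ hf1 hsub] at h0
    have hd2 : IntervalIntegrable (fun x => (deriv f x - ψ x) ^ 2) volume a b := by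
      refine (((hdf.pow 2).intervalIntegrable a b).add
        ((hψ.mul_continuousOn (g := fun x => -2 * deriv f x) (by fun_prop)).add hψ2)).congr_ae
        (ae_of_all _ fun x => ?_)
      simp only [Pi.pow_apply]
      ring
    have hFi := hψ2.sub (hQψ.const_mul 2)
    have hi1 := hFi.add (hψ2.const_mul (δ + K * δ))
    have hi2 := hi1.add ((hQ.intervalIntegrable_sq a b).const_mul (N * δ + 2 * K * δ))
    have hi3 := hi2.add (hd2.const_mul (δ⁻¹ + 1 + N * δ⁻¹ + K * δ))
    have hmono := intervalIntegral.integral_mono_on (μ := volume) hab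
      (((hdf.pow 2).intervalIntegrable a b).sub
        ((((hQ.intervalIntegrable a b).mul_continuousOn
          hf1.continuous.continuousOn).mul_continuousOn hdf.continuousOn).const_mul 2)) hi3
      (fun x hx => by
        have := quadraticForm_integrand_le (q := Q x) (ψ := ψ x) (d := deriv f x - ψ x)
          hδ (hN x (Icc_subset_uIcc hx)) (hclose x)
        simpa only [add_sub_cancel, Pi.pow_apply] using this)
    rw [intervalIntegral.integral_add hi2 (hd2.const_mul _),
      intervalIntegral.integral_add hi1 ((hQ.intervalIntegrable_sq a b).const_mul _),
      intervalIntegral.integral_add hFi (hψ2.const_mul _), intervalIntegral.integral_const_mul,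
      intervalIntegral.integral_const_mul, intervalIntegral.integral_const_mul] at hmono
    have h3 : (δ⁻¹ + 1 + N * δ⁻¹ + K * δ) * ∫ x in a..b, (deriv f x - ψ x) ^ 2 ≤
        (2 + N + K) * K * δ := by
      refine (mul_le_mul_of_nonneg_left hd (by positivity)).trans ?_
      have e : (δ⁻¹ + 1 + N * δ⁻¹ + K * δ) * (K * δ ^ 2) =
          (δ * δ⁻¹) * (K * δ) * (1 + N) + K * δ * (δ + K * (δ * δ)) := by ring
      rw [e, mul_inv_cancel₀ hδ.ne']
      have : δ + K * (δ * δ) ≤ 1 + K := by nlinarith [mul_le_one₀ hδ1 hδ.le hδ1]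
      nlinarith [mul_le_mul_of_nonneg_left this (mul_nonneg hK0 hδ.le)]
    have h0' := h0.trans hmono
    simp only [M]
    linarith
  by_contra! hneg
  have hM : F < 0 := hneg
  have hM0 : 0 ≤ |M| + 1 - M := by linarith [le_abs_self M]
  have hpos : 0 < |M| + 1 := by positivity
  have := main (min 1 (-F / 2 / (|M| + 1))) (lt_min one_pos (by
    apply div_pos _ hpos; linarith)) (min_le_left _ _)
  have h1 : M * min 1 (-F / 2 / (|M| + 1)) ≤ (|M| + 1) * (-F / 2 / (|M| + 1)) :=
    mul_le_mul (by linarith) (min_le_right _ _)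
      (le_min one_pos.le (div_nonneg (by linarith) hpos.le)) hpos.le
  rw [mul_div_cancel₀ _ hpos.ne'] at h1
  linarith

theorem primitive_eq_zero_of_notMem_Icc {ψ : ℝ → ℝ} {A B : ℝ}
    (hψ : ∀ a b, IntervalIntegrable ψ volume a b) (h0 : ∀ x, x ∉ Icc A B → ψ x = 0)
    (hmean : ∫ x in A..B, ψ x = 0) {x : ℝ} (hx : x ∉ Ioo A B) : ∫ t in A..x, ψ t = 0 := by
  have hae : ∀ c d : ℝ, (∀ t, t ∈ Ioo (min c d) (max c d) → t ∉ Icc A B) →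
      ∫ t in c..d, ψ t = 0 := by
    intro c d hcd
    rw [← intervalIntegral.integral_zero (a := c) (b := d) (μ := volume)]
    refine integral_congr_ae ?_
    have hne : ∀ᵐ t : ℝ, t ≠ max c d := by simp [ae_iff, measure_singleton]
    filter_upwards [hne] with t ht htm
    exact h0 t (hcd t ⟨htm.1, lt_of_le_of_ne htm.2 ht⟩)
  rcases le_or_gt x A with hxA | hxA
  · refine hae A x fun t ht ht' => ?_
    rw [max_eq_left hxA] at ht
    exact absurd ht'.1 (not_le.2 ht.2)
  · have hBx : B ≤ x := by
      by_contra! hxB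
      exact hx ⟨hxA, hxB⟩
    rw [← integral_add_adjacent_intervals (hψ A B) (hψ B x), hmean, zero_add]
    refine hae B x fun t ht ht' => ?_
    rw [min_eq_left hBx] at ht
    exact absurd ht'.2 (not_le.2 ht.1)

theorem abs_integral_le_of_integral_sq_le {h : ℝ → ℝ} {a b δ : ℝ} (hδ : 0 < δ)
    (hh : IntervalIntegrable h volume a b) (hh2 : IntervalIntegrable (fun x => h x ^ 2) volume a b)
    (hle : ∫ x in a..b, h x ^ 2 ≤ δ ^ 2) {c x : ℝ} (hc : c ∈ Icc a b) (hx : x ∈ Icc a b) :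
    |∫ t in c..x, h t| ≤ (b - a + 1) * δ := by
  have hab : a ≤ b := hc.1.trans hc.2
  have hi := ((intervalIntegrable_const (c := δ) (μ := volume) (a := a) (b := b)).add
    (hh2.const_mul δ⁻¹)).const_mul (1 / 2)
  have hsub : Set.uIoc c x ⊆ Set.uIoc a b := by
    rw [uIoc_of_le hab]
    exact fun t ht => ⟨lt_of_le_of_lt (le_min hc.1 hx.1) ht.1, ht.2.trans (max_le hc.2 hx.2)⟩
  have hIoc : IntegrableOn (fun t => |h t|) (Set.uIoc a b) := (intervalIntegrable_iff.1 hh).abs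
  calc |∫ t in c..x, h t| ≤ ∫ t in Set.uIoc c x, |h t| := by
        simpa only [Real.norm_eq_abs] using
          norm_integral_le_integral_norm_uIoc (f := h) (μ := volume)
    _ ≤ ∫ t in Set.uIoc a b, |h t| :=
        setIntegral_mono_set hIoc (ae_of_all _ fun t => abs_nonneg _) hsub.eventuallyLE
    _ = ∫ t in a..b, |h t| := by rw [integral_of_le hab, uIoc_of_le hab]
    _ ≤ ∫ t in a..b, 1 / 2 * (δ + δ⁻¹ * h t ^ 2) := by
        refine intervalIntegral.integral_mono_on hab hh.abs hi fun t _ => ?_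
        have h1 : 0 ≤ δ⁻¹ * (δ - |h t|) ^ 2 := by positivity
        have e : δ⁻¹ * (δ - |h t|) ^ 2 =
          (δ * δ⁻¹) * δ - 2 * (δ * δ⁻¹) * |h t| + δ⁻¹ * |h t| ^ 2 := by ring
        rw [e, mul_inv_cancel₀ hδ.ne', sq_abs] at h1
        linarith
    _ = 1 / 2 * ((b - a) * δ + δ⁻¹ * ∫ t in a..b, h t ^ 2) := by
        rw [intervalIntegral.integral_const_mul, intervalIntegral.integral_add
          intervalIntegrable_const (hh2.const_mul δ⁻¹), intervalIntegral.integral_const,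
          intervalIntegral.integral_const_mul, smul_eq_mul]
    _ ≤ 1 / 2 * ((b - a) * δ + δ⁻¹ * δ ^ 2) := by gcongr
    _ = 1 / 2 * ((b - a) * δ + δ) := by
        congr 2
        field_simp
    _ ≤ (b - a + 1) * δ := by nlinarith [mul_nonneg (sub_nonneg.2 hab) hδ.le]

/-- A square integrable function supported in `[A, B]` with vanishing mean is a limit of
derivatives of test functions. -/
theorem exists_testFunction_approx {ψ : ℝ → ℝ} {A B : ℝ} (hAB : A < B) (hψ : MemLp ψ 2 volume)
    (h0 : ∀ x, x ∉ Icc A B → ψ x = 0) (hmean : ∫ x in A..B, ψ x = 0) :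
    ∃ K : ℝ, ∀ δ : ℝ, 0 < δ → δ ≤ 1 → ∃ f : ℝ → ℝ, ContDiff ℝ (⊤ : ℕ∞) f ∧
      tsupport f ⊆ Ioo (A - 1) (B + 1) ∧ (∀ x, |f x - ∫ t in A..x, ψ t| ≤ K * δ) ∧
      ∫ x in (A - 1)..(B + 1), (deriv f x - ψ x) ^ 2 ≤ K * δ ^ 2 := by
  have hψi : ∀ a b, IntervalIntegrable ψ volume a b := fun a b =>
    ((hψ.locallyIntegrable (by norm_num)).integrableOn_isCompact isCompact_uIcc).intervalIntegrable
  let χ : ContDiffBump ((A + B) / 2) :=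
    { rIn := (B - A) / 2, rOut := (B - A) / 2 + 1 / 2, rIn_pos := by linarith,
      rIn_lt_rOut := by linarith }
  have hχ1 : ∀ x ∈ Icc A B, χ x = 1 := fun x hx => χ.one_of_mem_closedBall (by
    rw [Real.closedBall_eq_Icc]
    constructor <;> simp only [χ] <;> linarith [hx.1, hx.2])
  have hχs : tsupport χ ⊆ Ioo (A - 1) (B + 1) := by
    rw [χ.tsupport_eq, Real.closedBall_eq_Icc]
    intro x hx
    simp only [χ] at hx
    constructor <;> linarith [hx.1, hx.2]
  have hχc : ContDiff ℝ (⊤ : ℕ∞) χ := χ.contDiff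
  have hχc1 : ContDiff ℝ 1 χ := χ.contDiff
  have hχd : ∀ x ∈ Icc A B, deriv χ x = 0 := fun x hx =>
    IsLocalMax.deriv_eq_zero (Eventually.of_forall fun z => by rw [hχ1 x hx]; exact χ.le_one)
  have hχ0 : ∀ x, x ∉ Icc (A - 1) (B + 1) → χ x = 0 := fun x hx =>
    image_eq_zero_of_notMem_tsupport fun h => hx (Ioo_subset_Icc_self (hχs h))
  have hχabs : ∀ x, |χ x| ≤ 1 := fun x => abs_le.2 ⟨by linarith [χ.nonneg (x := x)], χ.le_one⟩
  obtain ⟨X, hX⟩ := (isCompact_Icc (a := A - 1) (b := B + 1)).exists_bound_of_continuousOn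
    hχc1.continuous_deriv_one.continuousOn
  have hX0 : 0 ≤ X := (abs_nonneg _).trans (hX A ⟨by linarith, by linarith⟩)
  set L := B + 1 - (A - 1) + 1
  have hL0 : 0 < L := by simp only [L]; linarith
  refine ⟨L + 2 * (X * L) ^ 2 * (B + 1 - (A - 1)) + 2, fun δ hδ hδ1 => ?_⟩
  obtain ⟨g, hgs, hgc, hg⟩ := MemLp.exist_eLpNorm_sub_le (by simp) (by norm_num) hψ hδ
  have hgcont : Continuous g := hgc.continuous
  have hgψ : MemLp (ψ - g) 2 volume := hψ.sub (hgcont.memLp_of_hasCompactSupport hgs)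
  have hsqint : Integrable fun x => (g x - ψ x) ^ 2 := by
    refine hgψ.integrable_sq.congr (ae_of_all _ fun x => ?_)
    simp only [Pi.sub_apply]
    ring
  have hsqle : ∫ x, (g x - ψ x) ^ 2 ≤ δ ^ 2 := by
    rw [hgψ.eLpNorm_eq_integral_rpow_norm (by norm_num) (by simp),
      ENNReal.ofReal_le_ofReal_iff hδ.le] at hg
    simp only [ENNReal.toReal_ofNat, Real.rpow_ofNat, Real.norm_eq_abs, sq_abs] at hg
    rw [← one_div, ← Real.sqrt_eq_rpow, Real.sqrt_le_left hδ.le] at hg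
    refine le_trans (le_of_eq (integral_congr_ae (ae_of_all _ fun x => ?_))) hg
    simp only [Pi.sub_apply]
    ring
  have hsqI : ∫ x in (A - 1)..(B + 1), (g x - ψ x) ^ 2 ≤ δ ^ 2 := by
    rw [integral_of_le (by linarith)]
    exact (setIntegral_le_integral hsqint (ae_of_all _ fun x => sq_nonneg _)).trans hsqle
  have hgi : ∀ a b, IntervalIntegrable g volume a b := hgcont.intervalIntegrable
  have hG : ∀ x ∈ Icc (A - 1) (B + 1), |(∫ t in A..x, g t) - ∫ t in A..x, ψ t| ≤ L * δ := by
    intro x hx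
    rw [← intervalIntegral.integral_sub (hgi _ _) (hψi _ _)]
    exact abs_integral_le_of_integral_sq_le hδ ((hgi _ _).sub (hψi _ _))
      hsqint.intervalIntegrable hsqI ⟨by linarith, by linarith⟩ hx
  have hGd : ∀ x, HasDerivAt (fun x => ∫ t in A..x, g t) (g x) x := fun x =>
    (hgcont.integral_hasStrictDerivAt A x).hasDerivAt
  have hGc : ContDiff ℝ (⊤ : ℕ∞) fun x => ∫ t in A..x, g t := by
    rw [contDiff_infty_iff_deriv]
    refine ⟨fun x => (hGd x).differentiableAt, ?_⟩
    rwa [show deriv (fun x => ∫ t in A..x, g t) = g from funext fun x => (hGd x).deriv]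
  have hp0 : ∀ x, x ∉ Icc A B → ∫ t in A..x, ψ t = 0 := fun x hx =>
    primitive_eq_zero_of_notMem_Icc hψi h0 hmean fun h => hx (Ioo_subset_Icc_self h)
  refine ⟨fun x => χ x * ∫ t in A..x, g t, hχc.mul hGc, ?_, fun x => ?_, ?_⟩
  · exact (tsupport_mul_subset_left (f := χ)).trans hχs
  · have e : (χ x * ∫ t in A..x, g t) - ∫ t in A..x, ψ t =
        χ x * ((∫ t in A..x, g t) - ∫ t in A..x, ψ t) := by
      by_cases hx : x ∈ Icc A B
      · rw [hχ1 x hx]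
        ring
      · rw [hp0 x hx]
        ring
    rw [e, abs_mul]
    have hle : L * δ ≤ (L + 2 * (X * L) ^ 2 * (B + 1 - (A - 1)) + 2) * δ := by
      gcongr
      nlinarith [sq_nonneg (X * L)]
    refine le_trans ?_ hle
    by_cases hx : x ∈ Icc (A - 1) (B + 1)
    · exact (mul_le_of_le_one_left (abs_nonneg _) (hχabs x)).trans (hG x hx)
    · rw [hχ0 x hx, abs_zero, zero_mul]
      positivity
  · have hd : ∀ x, deriv (fun x => χ x * ∫ t in A..x, g t) x - ψ x =
        deriv χ x * ((∫ t in A..x, g t) - ∫ t in A..x, ψ t) + χ x * (g x - ψ x) := by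
      intro x
      rw [((hχc1.differentiable one_ne_zero x).hasDerivAt.fun_mul (hGd x)).deriv]
      by_cases hx : x ∈ Icc A B
      · rw [hχ1 x hx, hχd x hx]
        ring
      · rw [hp0 x hx, h0 x hx]
        ring
    have hab : A - 1 ≤ B + 1 := by linarith
    have hψ2 : IntervalIntegrable (fun x => ψ x ^ 2) volume (A - 1) (B + 1) :=
      hψ.integrable_sq.intervalIntegrable
    have hdf : Continuous (deriv fun x => χ x * ∫ t in A..x, g t) :=
      ContDiff.continuous_deriv_one ((hχc.mul hGc).of_le (by exact_mod_cast le_top))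
    have hd2 : IntervalIntegrable
        (fun x => (deriv (fun x => χ x * ∫ t in A..x, g t) x - ψ x) ^ 2) volume
        (A - 1) (B + 1) := by
      refine (((hdf.pow 2).intervalIntegrable _ _).add
        (((hψi _ _).mul_continuousOn
          (g := fun x => -2 * deriv (fun x => χ x * ∫ t in A..x, g t) x)
          (hdf.const_mul _).continuousOn).add hψ2)).congr_ae (ae_of_all _ fun x => ?_)
      simp only [Pi.pow_apply]
      ring
    have hright : IntervalIntegrable
        (fun x => 2 * (X * (L * δ)) ^ 2 + 2 * (g x - ψ x) ^ 2) volume (A - 1) (B + 1) :=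
      intervalIntegrable_const.add (hsqint.intervalIntegrable.const_mul 2)
    refine (intervalIntegral.integral_mono_on hab hd2 hright fun x hx => ?_).trans ?_
    · rw [hd x]
      have h1 : (deriv χ x * ((∫ t in A..x, g t) - ∫ t in A..x, ψ t)) ^ 2 ≤
          (X * (L * δ)) ^ 2 := by
        rw [← sq_abs, abs_mul]
        have := mul_le_mul (hX x hx) (hG x hx) (abs_nonneg _) hX0
        exact pow_le_pow_left₀ (by positivity) this 2
      have h2 : (χ x * (g x - ψ x)) ^ 2 ≤ (g x - ψ x) ^ 2 := by
        rw [mul_pow]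
        exact mul_le_of_le_one_left (sq_nonneg _) ((sq_le_one_iff_abs_le_one _).2 (hχabs x))
      linarith [add_sq_le (a := deriv χ x * ((∫ t in A..x, g t) - ∫ t in A..x, ψ t))
        (b := χ x * (g x - ψ x))]
    · rw [intervalIntegral.integral_add intervalIntegrable_const
        (hsqint.intervalIntegrable.const_mul 2), intervalIntegral.integral_const,
        intervalIntegral.integral_const_mul, smul_eq_mul]
      nlinarith [mul_nonneg hL0.le (sq_nonneg δ)]

/-- Nonnegativity of the quadratic form on square integrable functions of vanishing mean. -/
theorem LqNonneg.integral_nonneg {Q ψ : ℝ → ℝ} {A B : ℝ} (hQ : LocL2 Q) (h : LqNonneg Q)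
    (hAB : A < B) (hψ : MemLp ψ 2 volume) (h0 : ∀ x, x ∉ Icc A B → ψ x = 0)
    (hmean : ∫ x in A..B, ψ x = 0) :
    0 ≤ ∫ x in A..B, (ψ x ^ 2 - 2 * (Q x * (∫ t in A..x, ψ t) * ψ x)) := by
  have hψi : ∀ a b, IntervalIntegrable ψ volume a b := fun a b =>
    ((hψ.locallyIntegrable (by norm_num)).integrableOn_isCompact isCompact_uIcc).intervalIntegrable
  obtain ⟨K, hK⟩ := exists_testFunction_approx hAB hψ h0 hmean
  have hmain := h.integral_nonneg_of_approx (φ := fun x => ∫ t in A..x, ψ t) hQ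
    (by linarith : A - 1 ≤ B + 1) (continuous_primitive hψi A).continuousOn (hψi _ _)
    hψ.integrable_sq.intervalIntegrable hK
  refine hmain.trans_eq ?_
  rw [integral_of_le (by linarith), integral_of_le hAB.le, ← integral_Icc_eq_integral_Ioc,
    ← integral_Icc_eq_integral_Ioc]
  refine setIntegral_eq_of_subset_of_forall_sdiff_eq_zero measurableSet_Icc
    (Icc_subset_Icc (by linarith) (by linarith)) fun x hx => ?_
  simp [h0 x hx.2]

theorem SolvesWith.linear_combination {Q y₁ u₁ y₂ u₂ : ℝ → ℝ} (hQ : LocL2 Q)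
    (h₁ : SolvesWith Q y₁ u₁) (h₂ : SolvesWith Q y₂ u₂) (α β : ℝ) :
    SolvesWith Q (fun x => α * y₁ x + β * y₂ x) (fun x => α * u₁ x + β * u₂ x) := by
  obtain ⟨hy₁, hu₁⟩ := h₁.continuous hQ
  obtain ⟨hy₂, hu₂⟩ := h₂.continuous hQ
  constructor <;> intro x
  · have hd := ((h₁.hasACDeriv hQ hy₁ hu₁ 0 x).1.const_mul α).add
      ((h₂.hasACDeriv hQ hy₂ hu₂ 0 x).1.const_mul β)
    have e := (hd.congr_deriv (g := fun t => Q t * (α * y₁ t + β * y₂ t) + (α * u₁ t + β * u₂ t))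
      (ae_of_all _ fun t => by ring)).integral_eq_sub
    rw [e]
    ring
  · have hd := ((h₁.hasACDeriv hQ hy₁ hu₁ 0 x).2.const_mul α).add
      ((h₂.hasACDeriv hQ hy₂ hu₂ 0 x).2.const_mul β)
    have e := (hd.congr_deriv (g := fun t => -(Q t) ^ 2 * (α * y₁ t + β * y₂ t) -
      Q t * (α * u₁ t + β * u₂ t)) (ae_of_all _ fun t => by ring)).integral_eq_sub
    rw [e]
    ring

theorem eq_zero_of_forall_quadratic_nonneg {v c : ℝ} (h : ∀ s : ℝ, 0 ≤ -(2 * s * v) + c * s ^ 2) :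
    v = 0 := by
  by_contra hv
  have hc : 0 < |c| + 1 := by positivity
  have h1 := h (v / (|c| + 1))
  have e : -(2 * (v / (|c| + 1)) * v) + c * (v / (|c| + 1)) ^ 2 =
      (v / (|c| + 1)) ^ 2 * (c - 2 * (|c| + 1)) := by
    field_simp
    ring
  rw [e] at h1
  have h2 : 0 < (v / (|c| + 1)) ^ 2 := by positivity
  nlinarith [le_abs_self c, abs_nonneg c]

/-- Disconjugacy: a solution with two zeros is trivial. -/
theorem LqNonneg.companion_eq_zero {Q y u : ℝ → ℝ} (hQ : LocL2 Q) (h : LqNonneg Q)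
    (hs : SolvesWith Q y u) {a b : ℝ} (hab : a < b) (ha : y a = 0) (hb : y b = 0) : u a = 0 := by
  obtain ⟨hy, hu⟩ := hs.continuous hQ
  have hba : 0 < b - a := sub_pos.2 hab
  obtain ⟨hdy, hdu⟩ := hs.hasACDeriv hQ hy hu a b
  have hg := intervalIntegrable_coeff_of_continuous hQ hy hu
  set k := (b - a)⁻¹
  have hkba : k * (b - a) = 1 := inv_mul_cancel₀ hba.ne'
  have hmeas : ∀ s, Measurable fun x => Q x * y x + u x - s * k := fun s =>
    ((hQ.1.mul hy.measurable).add hu.measurable).sub_const _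
  refine eq_zero_of_forall_quadratic_nonneg
    (c := (∫ x in (a - 1)..a, (1 - 2 * (Q x * (x - (a - 1))))) +
      ∫ x in a..b, (k ^ 2 + 2 * (Q x * (k * (b - x)) * k))) fun s => ?_
  let ψ : ℝ → ℝ := fun x => (Ioc (a - 1) a).indicator (fun _ => s) x +
    (Ioc a b).indicator (fun x => Q x * y x + u x - s * k) x
  have hψ1 : ∀ x ∈ Ioc (a - 1) a, ψ x = s := fun x hx => by
    simp [ψ, hx, show x ∉ Ioc a b from fun h => absurd hx.2 (not_le.2 h.1)]
  have hψ2 : ∀ x ∈ Ioc a b, ψ x = Q x * y x + u x - s * k := fun x hx => by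
    simp [ψ, hx, show x ∉ Ioc (a - 1) a from fun h => absurd h.2 (not_le.2 hx.1)]
  have hψ0 : ∀ x, x ∉ Icc (a - 1) b → ψ x = 0 := fun x hx => by
    have h1 : x ∉ Ioc (a - 1) a := fun h => hx ⟨h.1.le, h.2.trans hab.le⟩
    have h2 : x ∉ Ioc a b := fun h => hx ⟨by linarith [h.1], h.2⟩
    simp [ψ, h1, h2]
  have hψ : MemLp ψ 2 volume := by
    refine (memLp_indicator_const 2 measurableSet_Ioc s (Or.inr (by simp))).add ?_
    rw [memLp_indicator_iff_restrict measurableSet_Ioc,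
      memLp_two_iff_integrable_sq (hmeas s).aestronglyMeasurable]
    have hi := ((hQ.intervalIntegrable_sq a b).mul_continuousOn (hy.pow 2).continuousOn).add
      (((hQ.intervalIntegrable a b).mul_continuousOn (g := fun x => 2 * y x * (u x - s * k))
        (by fun_prop)).add (((hu.sub (continuous_const (y := s * k))).pow
          2).intervalIntegrable a b))
    refine Integrable.congr ((intervalIntegrable_iff_integrableOn_Ioc_of_le hab.le).1 hi)
      (ae_of_all _ fun x => ?_)
    simp only [Pi.pow_apply, Pi.sub_apply]
    ring
  have hψi : ∀ a b, IntervalIntegrable ψ volume a b := fun a b =>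
    ((hψ.locallyIntegrable (by norm_num)).integrableOn_isCompact
      isCompact_uIcc).intervalIntegrable
  have hφ1 : ∀ x ∈ Icc (a - 1) a, ∫ t in (a - 1)..x, ψ t = s * (x - (a - 1)) := by
    intro x hx
    have e : ∫ t in (a - 1)..x, ψ t = ∫ t in (a - 1)..x, s :=
      integral_congr_ae <| ae_of_all _ fun t ht => by
        rw [uIoc_of_le hx.1] at ht
        exact hψ1 t ⟨ht.1, ht.2.trans hx.2⟩
    rw [e, intervalIntegral.integral_const, smul_eq_mul]
    ring
  have hφ2 : ∀ x ∈ Icc a b, ∫ t in (a - 1)..x, ψ t = y x + s * (k * (b - x)) := by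
    intro x hx
    have e : ∫ t in a..x, ψ t = ∫ t in a..x, (Q t * y t + u t - s * k) :=
      integral_congr_ae <| ae_of_all _ fun t ht => by
        rw [uIoc_of_le hx.1] at ht
        exact hψ2 t ⟨ht.1, ht.2.trans hx.2⟩
    rw [← integral_add_adjacent_intervals (hψi (a - 1) a) (hψi a x), hφ1 a ⟨by linarith, le_rfl⟩,
      e, intervalIntegral.integral_sub (hg a x).1 intervalIntegrable_const,
      (hs.hasACDeriv hQ hy hu a x).1.integral_eq_sub, ha, intervalIntegral.integral_const,
      smul_eq_mul]
    linear_combination (-s) * hkba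
  have hmain := h.integral_nonneg hQ (by linarith : a - 1 < b) hψ hψ0
    (by rw [hφ2 b ⟨hab.le, le_rfl⟩, hb]; ring)
  have hi1 : IntervalIntegrable (fun x => s ^ 2 * (1 - 2 * (Q x * (x - (a - 1))))) volume
      (a - 1) a :=
    (intervalIntegrable_const.sub (((hQ.intervalIntegrable _ _).mul_continuousOn
      (by fun_prop)).const_mul 2)).const_mul _
  have hi2 : IntervalIntegrable (fun x => s ^ 2 * (k ^ 2 + 2 * (Q x * (k * (b - x)) * k))) volume
      a b :=
    (intervalIntegrable_const.add ((((hQ.intervalIntegrable _ _).mul_continuousOn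
      (by fun_prop)).mul_const k).const_mul 2)).const_mul _
  have hl : HasACDeriv (fun x => k * (b - x)) (fun _ => -k) a b := by
    have h1 : ContDiff ℝ 1 fun x : ℝ => k * (b - x) := by fun_prop
    refine (HasACDeriv.of_contDiff h1).congr_deriv (ae_of_all _ fun x => ?_)
    simp
  have hW := (hdy.mul hdu).add ((hl.mul hdu).const_mul (2 * s))
  have e1 : EqOn (fun x => ψ x ^ 2 - 2 * (Q x * (∫ t in (a - 1)..x, ψ t) * ψ x))
      (fun x => s ^ 2 * (1 - 2 * (Q x * (x - (a - 1))))) (Set.uIoc (a - 1) a) := fun x hx => by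
    rw [uIoc_of_le (by linarith)] at hx
    simp only [hψ1 x hx, hφ1 x (Ioc_subset_Icc_self hx)]
    ring
  have e2 : EqOn (fun x => ψ x ^ 2 - 2 * (Q x * (∫ t in (a - 1)..x, ψ t) * ψ x))
      (fun x => ((Q x * y x + u x) * u x + y x * (-(Q x) ^ 2 * y x - Q x * u x) +
        2 * s * (-k * u x + k * (b - x) * (-(Q x) ^ 2 * y x - Q x * u x))) +
        s ^ 2 * (k ^ 2 + 2 * (Q x * (k * (b - x)) * k))) (Set.uIoc a b) := fun x hx => by
    rw [uIoc_of_le hab.le] at hx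
    simp only [hψ2 x hx, hφ2 x (Ioc_subset_Icc_self hx)]
    ring
  rw [← integral_add_adjacent_intervals ((intervalIntegrable_congr e1).2 hi1)
    ((intervalIntegrable_congr e2).2 (hW.intervalIntegrable.add hi2)),
    integral_congr_ae (ae_of_all _ fun x hx => e1 hx),
    integral_congr_ae (ae_of_all _ fun x hx => e2 hx),
    intervalIntegral.integral_add hW.intervalIntegrable hi2, hW.integral_eq_sub,
    intervalIntegral.integral_const_mul, intervalIntegral.integral_const_mul, ha, hb,
    hkba] at hmain
  linarith

theorem pos_of_continuous_of_forall_ne_zero {f : ℝ → ℝ} (hf : Continuous f) {a b : ℝ}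
    (ha : 0 < f a) (h : ∀ x ∈ uIcc a b, f x ≠ 0) : 0 < f b := by
  by_contra! hb
  obtain ⟨x, hx, hx0⟩ := intermediate_value_uIcc (a := a) (b := b) hf.continuousOn
    (mem_uIcc.2 (Or.inr ⟨hb, ha.le⟩))
  exact h x hx hx0

/-- If nontrivial combinations of two continuous functions have at most one zero, then some
combination is positive. -/
theorem exists_pos_combination {f g : ℝ → ℝ} (hf : Continuous f) (hg : Continuous g)
    (hf0 : f 0 = 1) (hg0 : g 0 = 0)
    (h : ∀ α β p q : ℝ, p < q → α * f p + β * g p = 0 → α * f q + β * g q = 0 → α = 0 ∧ β = 0) :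
    ∃ m : ℝ, ∀ x, 0 < f x + m * g x := by
  wlog hg1 : 0 ≤ g 1 generalizing g with H
  · obtain ⟨m, hm⟩ := H hg.neg (by simp [hg0])
      (fun α β p q hpq hp hq => by
        have := h α (-β) p q hpq (by simpa using hp) (by simpa using hq)
        simpa using this) (by simpa using (not_le.1 hg1).le)
    exact ⟨-m, fun x => by simpa using hm x⟩
  have h' : ∀ α β p q : ℝ, p ≠ q → α * f p + β * g p = 0 → α * f q + β * g q = 0 →
      α = 0 ∧ β = 0 := fun α β p q hpq hp hq => by
    rcases lt_or_gt_of_ne hpq with hlt | hlt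
    · exact h α β p q hlt hp hq
    · exact h α β q p hlt hq hp
  have hgne : ∀ x, x ≠ 0 → g x ≠ 0 := fun x hx hgx => by
    simpa using (h' 0 1 x 0 hx (by simp [hgx]) (by simp [hg0])).2
  have key : ∀ c x, c ≠ 0 → c ∉ uIcc 0 x → 0 < f x - f c / g c * g x := by
    intro c x hc hcx
    refine pos_of_continuous_of_forall_ne_zero (f := fun x => f x - f c / g c * g x) (a := 0)
      (by fun_prop) (by simp [hf0, hg0]) fun z hz hz0 => ?_
    have hzc : z ≠ c := fun e => hcx (e ▸ hz)
    have := (h' 1 (-(f c / g c)) z c hzc (by linarith) (by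
      field_simp [hgne c hc]
      ring)).1
    exact one_ne_zero this
  have hgpos : ∀ x, 0 < x → 0 < g x := fun x hx =>
    pos_of_continuous_of_forall_ne_zero hg (lt_of_le_of_ne hg1 (hgne 1 one_ne_zero).symm)
      fun z hz => hgne z ((lt_min one_pos hx).trans_le hz.1).ne'
  have hgneg1 : g (-1) < 0 := by
    by_contra! hle
    have hlt := lt_of_le_of_ne hle (hgne (-1) (by norm_num)).symm
    have h1 := hgpos 1 one_pos
    have k1 := key 1 (-1) one_ne_zero (by rw [mem_uIcc]; norm_num)
    have k2 := key (-1) 1 (by norm_num) (by rw [mem_uIcc]; norm_num)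
    rw [sub_pos, ← lt_div_iff₀ (by assumption)] at k1 k2
    exact lt_asymm k1 k2
  have hgneg : ∀ x, x < 0 → g x < 0 := fun x hx => by
    have := pos_of_continuous_of_forall_ne_zero (f := fun z => -g z) hg.neg (neg_pos.2 hgneg1)
      (b := x) fun z hz => neg_ne_zero.2 (hgne z (hz.2.trans_lt (max_lt (by norm_num) hx)).ne)
    linarith
  have hpp : ∀ a a', 0 < a → a < a' → -(f a / g a) < -(f a' / g a') := fun a a' ha haa' => by
    have := key a' a (ha.trans haa').ne' (by rw [mem_uIcc]; grind)
    rw [sub_pos, ← lt_div_iff₀ (hgpos a ha)] at this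
    linarith
  have hnp : ∀ a b, 0 < a → b < 0 → -(f a / g a) < -(f b / g b) := fun a b ha hb => by
    have := key a b ha.ne' (by rw [mem_uIcc]; grind)
    rw [sub_pos, ← div_lt_iff_of_neg (hgneg b hb)] at this
    linarith
  have hnn : ∀ b b', b < 0 → b' < b → -(f b' / g b') < -(f b / g b) := fun b b' hb hbb' => by
    have := key b' b (hbb'.trans hb).ne (by rw [mem_uIcc]; grind)
    rw [sub_pos, ← div_lt_iff_of_neg (hgneg b hb)] at this
    linarith
  let S := (fun a => -(f a / g a)) '' Ioi (0 : ℝ)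
  have hS : ∀ b, b < 0 → -(f b / g b) ∈ upperBounds S := by
    rintro b hb _ ⟨a, ha, rfl⟩
    exact (hnp a b ha hb).le
  refine ⟨sSup S, fun x => ?_⟩
  rcases lt_trichotomy x 0 with hx | rfl | hx
  · have h1 : sSup S ≤ -(f (x - 1) / g (x - 1)) :=
      csSup_le (nonempty_Ioi.image _) (hS (x - 1) (by linarith))
    have h2 := h1.trans_lt (hnn x (x - 1) hx (by linarith))
    have h3 := mul_lt_mul_of_neg_right h2 (hgneg x hx)
    rw [neg_mul, div_mul_cancel₀ _ (hgneg x hx).ne] at h3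
    linarith
  · simp [hf0, hg0]
  · have h1 : -(f (x + 1) / g (x + 1)) ≤ sSup S :=
      le_csSup ⟨_, hS (-1) (by norm_num)⟩ (mem_image_of_mem _ (by simp only [mem_Ioi]; linarith))
    have h2 := (hpp x (x + 1) hx (by linarith)).trans_le h1
    have h3 := mul_lt_mul_of_pos_right h2 (hgpos x hx)
    rw [neg_mul, div_mul_cancel₀ _ (hgpos x hx).ne'] at h3
    linarith

theorem LqNonneg.exists_pos_solves {Q : ℝ → ℝ} (hQ : LocL2 Q) (h : LqNonneg Q) :
    ∃ y : ℝ → ℝ, Solves Q y ∧ ∀ x : ℝ, 0 < y x := by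
  obtain ⟨y₁, u₁, hy₁, hu₁, h₁, hy₁0, hu₁0⟩ := exists_solvesWith hQ 1 0
  obtain ⟨y₂, u₂, hy₂, hu₂, h₂, hy₂0, hu₂0⟩ := exists_solvesWith hQ 0 1
  obtain ⟨m, hm⟩ := exists_pos_combination hy₁ hy₂ hy₁0 hy₂0 fun α β p q hpq hp hq => by
    have hz := h₁.linear_combination hQ h₂ α β
    have hup := h.companion_eq_zero hQ hz hpq hp hq
    obtain ⟨hdz, hdw⟩ := hz.hasACDeriv hQ (by fun_prop) (by fun_prop) p 0
    have hd₁ := h₁.hasACDeriv hQ hy₁ hu₁ p 0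
    have hd₂ := h₂.hasACDeriv hQ hy₂ hu₂ p 0
    have e1 := wronskian_eq hdz hdw hd₁.1 hd₁.2
    have e2 := wronskian_eq hdz hdw hd₂.1 hd₂.2
    simp only [hp, hup, hy₁0, hu₁0, hy₂0, hu₂0] at e1 e2
    constructor <;> linarith
  exact ⟨fun x => 1 * y₁ x + m * y₂ x, ⟨_, h₁.linear_combination hQ h₂ 1 m⟩, fun x => by
    simpa using hm x⟩

/-- **Theorem 1 (characterization of the image of the Miura map).**
For `q = Q' ∈ H⁻¹_loc(ℝ)` with `Q ∈ L²_loc(ℝ;ℝ)`, the following are equivalent: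
(i) `q = r' + r²` for some real-valued `r ∈ L²_loc(ℝ)`;
(ii) `L_q y = 0` has a strictly positive solution;
(iii) `L_q ≥ 0`. -/
theorem miura_image_characterization (Q : ℝ → ℝ) (hQ : LocL2 Q) :
    ((∃ r : ℝ → ℝ, LocL2 r ∧ Riccati Q r) ↔
      (∃ y : ℝ → ℝ, Solves Q y ∧ ∀ x : ℝ, 0 < y x)) ∧
    ((∃ y : ℝ → ℝ, Solves Q y ∧ ∀ x : ℝ, 0 < y x) ↔ LqNonneg Q) := by
  refine ⟨⟨fun ⟨r, hr, h⟩ => h.exists_pos_solves hr, fun ⟨y, hy, hpos⟩ =>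
    exists_riccati_of_pos_solves hQ hy hpos⟩, fun ⟨y, hy, hpos⟩ => ?_, fun h =>
    h.exists_pos_solves hQ⟩
  obtain ⟨r, hr, h⟩ := exists_riccati_of_pos_solves hQ hy hpos
  exact h.lqNonneg hQ hr
end

section
/- Let I ⊆ ℝ be an open interval, Q ∈ L²_loc(I; ℝ), and let y be a solution of L_q y = 0 on I (with q = Q'), i.e. y is locally absolutely continuous on I and u := y' − Q·y has a locally absolutely continuous representative with u' = −Q²·y − Q·u almost everywhere on I. Suppose y(x₀) = 0 for some x₀ ∈ I. Then: (i) if u(x₀) = 0 then y ≡ 0 on I; (ii) if u(x₀) > 0 then there is δ > 0 such that y(x) < 0 for x ∈ (x₀ − δ, x₀) ∩ I and y(x) > 0 for x ∈ (x₀, x₀ + δ) ∩ I; (iii) if u(x₀) < 0 then there is δ > 0 such that y(x) > 0 for x ∈ (x₀ − δ, x₀) ∩ I and y(x) < 0 for x ∈ (x₀, x₀ + δ) ∩ I. In particular, if y is not identically zero then all zeros of y in I are isolated. -/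
open MeasureTheory Filter Set intervalIntegral ENNReal

/-- `Q` is locally square integrable on the interval `I`. -/
def LocL2On (I : Set ℝ) (Q : ℝ → ℝ) : Prop :=
  Measurable Q ∧ ∀ a b : ℝ, a ∈ I → b ∈ I → IntegrableOn (fun x => Q x ^ 2) (Set.Icc a b) volume

/-- `y` together with the companion function `u` (representing `u = y' - Q·y`) solves, on the
interval `I`, the first-order system `y' = Q y + u`, `u' = -Q² y - Q u` equivalent to
`L_q y = 0` with `q = Q'`, expressed through integral equations (encoding local absolute
continuity on `I`). -/
def SolvesWithOn (I : Set ℝ) (Q y u : ℝ → ℝ) : Prop :=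
  ∀ a ∈ I, ∀ b ∈ I,
    y b = y a + (∫ t in a..b, (Q t * y t + u t)) ∧
    u b = u a + (∫ t in a..b, (-(Q t) ^ 2 * y t - Q t * u t))

/-- A function satisfying an integral equation on an open interval is continuous there, even if the
integrand is not assumed integrable: failure of local integrability forces it to be constant. -/
theorem continuousOn_of_eq_add_integral {I : Set ℝ} (hIo : IsOpen I) (hIc : I.OrdConnected)
    {f g : ℝ → ℝ} (h : ∀ a ∈ I, ∀ b ∈ I, g b = g a + ∫ t in a..b, f t) :
    ContinuousOn g I := by
  by_cases hloc : ∀ p ∈ I, ∃ a ∈ I, ∃ b ∈ I, a < p ∧ p < b ∧ IntervalIntegrable f volume a b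
  · intro p hp
    obtain ⟨a, ha, b, hb, hap, hpb, hf⟩ := hloc p hp
    have hc : ContinuousOn (fun x => g a + ∫ t in a..x, f t) (uIcc a b) :=
      (continuousOn_primitive_interval' hf left_mem_uIcc).const_add _
    rw [uIcc_of_le (hap.trans hpb).le] at hc
    have hc' : ContinuousOn g (Icc a b) :=
      hc.congr fun x hx => h a ha x (hIc.out ha hb hx)
    exact (hc'.continuousAt (Icc_mem_nhds hap hpb)).continuousWithinAt
  · push Not at hloc
    obtain ⟨p, hp, hnot⟩ := hloc
    have hjump : ∀ a ∈ I, ∀ b ∈ I, a < p → p < b → g b = g a := by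
      intro a ha b hb hap hpb
      rw [h a ha b hb, integral_undef (hnot a ha b hb hap hpb), add_zero]
    obtain ⟨ε, hε, hball⟩ := Metric.isOpen_iff.mp hIo p hp
    have hc : p - ε / 2 ∈ I := hball (by rw [Real.ball_eq_Ioo]; constructor <;> linarith)
    have hd : p + ε / 2 ∈ I := hball (by rw [Real.ball_eq_Ioo]; constructor <;> linarith)
    have hcp : p - ε / 2 < p := by linarith
    have hpd : p < p + ε / 2 := by linarith
    have hcd := hjump _ hc _ hd hcp hpd
    refine (continuousOn_const (c := g (p - ε / 2))).congr fun x hx => ?_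
    rcases lt_trichotomy x p with hxp | rfl | hxp
    · rw [← hjump x hx _ hd hxp hpd, hcd]
    · by_cases hl : IntervalIntegrable f volume (x - ε / 2) x
      · have hr : ¬ IntervalIntegrable f volume x (x + ε / 2) := fun hr =>
          hnot _ hc _ hd hcp hpd (hl.trans hr)
        rw [← hcd, h x hx _ hd, integral_undef hr, add_zero]
      · rw [h _ hc x hx, integral_undef hl, add_zero]
    · exact hjump _ hc x hx hcp hxp

/-- The integral of a locally integrable function is small near any point. -/
theorem exists_ball_abs_integral_le {I : Set ℝ} (hIo : IsOpen I) (hIc : I.OrdConnected)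
    {f : ℝ → ℝ} (hf : ∀ a ∈ I, ∀ b ∈ I, IntervalIntegrable f volume a b)
    {p : ℝ} (hp : p ∈ I) {η : ℝ} (hη : 0 < η) :
    ∃ ε > 0, Metric.ball p ε ⊆ I ∧
      ∀ a ∈ Metric.ball p ε, ∀ b ∈ Metric.ball p ε, |∫ t in a..b, f t| ≤ η := by
  have hc : ContinuousOn (fun x => ∫ t in p..x, f t) I :=
    continuousOn_of_eq_add_integral hIo hIc fun a ha b hb =>
      (integral_add_adjacent_intervals (hf p hp a ha) (hf a ha b hb)).symm
  have hca := hc.continuousAt (hIo.mem_nhds hp)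
  obtain ⟨ε₁, hε₁, h₁⟩ := Metric.continuousAt_iff.mp hca (η / 2) (by positivity)
  obtain ⟨ε₂, hε₂, h₂⟩ := Metric.isOpen_iff.mp hIo p hp
  have hsub : Metric.ball p (min ε₁ ε₂) ⊆ I :=
    (Metric.ball_subset_ball (min_le_right _ _)).trans h₂
  refine ⟨min ε₁ ε₂, lt_min hε₁ hε₂, hsub, fun a ha b hb => ?_⟩
  have hsmall : ∀ x ∈ Metric.ball p (min ε₁ ε₂), |∫ t in p..x, f t| < η / 2 := by
    intro x hx
    simpa [Real.dist_eq] using h₁ (lt_of_lt_of_le hx (min_le_left _ _))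
  rw [← integral_interval_sub_left (hf p hp b (hsub hb)) (hf p hp a (hsub ha))]
  have := abs_sub (∫ t in p..b, f t) (∫ t in p..a, f t)
  linarith [hsmall a ha, hsmall b hb]

theorem LocL2On.intervalIntegrable_sq {I : Set ℝ} {Q : ℝ → ℝ} (hQ : LocL2On I Q) {a b : ℝ}
    (ha : a ∈ I) (hb : b ∈ I) : IntervalIntegrable (fun x => Q x ^ 2) volume a b :=
  ⟨(hQ.2 a b ha hb).mono_set Ioc_subset_Icc_self, (hQ.2 b a hb ha).mono_set Ioc_subset_Icc_self⟩

theorem LocL2On.intervalIntegrable_bound {I : Set ℝ} {Q : ℝ → ℝ} (hQ : LocL2On I Q) {a b : ℝ}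
    (ha : a ∈ I) (hb : b ∈ I) : IntervalIntegrable (fun x => 2 + 2 * Q x ^ 2) volume a b :=
  intervalIntegrable_const.add ((hQ.intervalIntegrable_sq ha hb).const_mul 2)

theorem LocL2On.intervalIntegrable {I : Set ℝ} {Q : ℝ → ℝ} (hQ : LocL2On I Q) {a b : ℝ}
    (ha : a ∈ I) (hb : b ∈ I) : IntervalIntegrable Q volume a b := by
  refine (hQ.intervalIntegrable_bound ha hb).mono_fun hQ.1.aestronglyMeasurable
    (Eventually.of_forall fun x => ?_)
  simp only [Real.norm_eq_abs]
  rw [abs_of_nonneg (by positivity : 0 ≤ 2 + 2 * Q x ^ 2), ← sq_abs (Q x)]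
  nlinarith [sq_nonneg (|Q x| - 1)]

theorem SolvesWithOn.continuousOn_fst {I : Set ℝ} (hIo : IsOpen I) (hIc : I.OrdConnected)
    {Q y u : ℝ → ℝ} (hy : SolvesWithOn I Q y u) : ContinuousOn y I :=
  continuousOn_of_eq_add_integral hIo hIc fun a ha b hb => (hy a ha b hb).1

theorem SolvesWithOn.continuousOn_snd {I : Set ℝ} (hIo : IsOpen I) (hIc : I.OrdConnected)
    {Q y u : ℝ → ℝ} (hy : SolvesWithOn I Q y u) : ContinuousOn u I :=
  continuousOn_of_eq_add_integral hIo hIc fun a ha b hb => (hy a ha b hb).2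

/-- Local uniqueness for the first-order system. -/
theorem SolvesWithOn.exists_ball_eq_zero {I : Set ℝ} (hIo : IsOpen I) (hIc : I.OrdConnected)
    {Q y u : ℝ → ℝ} (hQ : LocL2On I Q) (hy : SolvesWithOn I Q y u) {p : ℝ} (hp : p ∈ I) :
    ∃ ε > 0, Metric.ball p ε ⊆ I ∧ ∀ z ∈ Metric.ball p ε, ∀ w ∈ Metric.ball p ε,
      y z = 0 → u z = 0 → y w = 0 ∧ u w = 0 := by
  obtain ⟨ε, hε, hsub, hsmall⟩ := exists_ball_abs_integral_le hIo hIc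
    (fun a ha b hb => hQ.intervalIntegrable_bound ha hb) hp (η := 1 / 4) (by norm_num)
  refine ⟨ε, hε, hsub, fun z hz w hw hyz huz => ?_⟩
  have hball : uIcc z w ⊆ Metric.ball p ε := by
    rw [Real.ball_eq_Ioo] at hz hw ⊢
    exact ordConnected_Ioo.uIcc_subset hz hw
  have hcont : ContinuousOn (fun x => |y x| + |u x|) (uIcc z w) :=
    (((hy.continuousOn_fst hIo hIc).abs).add ((hy.continuousOn_snd hIo hIc).abs)).mono
      (hball.trans hsub)
  obtain ⟨s, hs, hmax⟩ := isCompact_uIcc.exists_isMaxOn nonempty_uIcc hcont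
  set M := |y s| + |u s| with hM
  have hmaxM : ∀ t ∈ uIcc z w, |y t| + |u t| ≤ M := fun t ht => hmax ht
  have hM0 : 0 ≤ M := by positivity
  have hest : ∀ F : ℝ → ℝ, (∀ t ∈ uIcc z w, |F t| ≤ (2 + 2 * Q t ^ 2) * M) →
      |∫ t in z..s, F t| ≤ 1 / 4 * M := by
    intro F hF
    have h₁ := norm_integral_le_abs_of_norm_le (μ := volume) (a := z) (b := s) (f := F)
      (g := fun t => (2 + 2 * Q t ^ 2) * M)
      ((ae_restrict_iff' measurableSet_uIoc).mpr (Eventually.of_forall fun t ht =>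
        hF t (uIcc_subset_uIcc_left hs (uIoc_subset_uIcc ht))))
      ((hQ.intervalIntegrable_bound (hsub hz) (hsub (hball hs))).mul_const M)
    rw [intervalIntegral.integral_mul_const, abs_mul, abs_of_nonneg hM0] at h₁
    exact h₁.trans (mul_le_mul_of_nonneg_right (hsmall z hz s (hball hs)) hM0)
  have hys : |y s| ≤ 1 / 4 * M := by
    have := (hy z (hsub hz) s (hsub (hball hs))).1
    rw [hyz, zero_add] at this
    rw [this]
    refine hest _ fun t ht => ?_
    have h₁ : |Q t * y t + u t| ≤ |Q t| * |y t| + |u t| := by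
      rw [← abs_mul]; exact abs_add_le _ _
    refine h₁.trans (le_trans ?_ (mul_le_mul_of_nonneg_left (hmaxM t ht) (by positivity)))
    rw [← sq_abs (Q t)]
    have h₂ : |Q t| ≤ 2 + 2 * |Q t| ^ 2 := by nlinarith [sq_nonneg (|Q t| - 1)]
    have h₃ : 1 ≤ 2 + 2 * |Q t| ^ 2 := by nlinarith [sq_nonneg (|Q t|)]
    nlinarith [mul_le_mul_of_nonneg_right h₂ (abs_nonneg (y t)),
      mul_le_mul_of_nonneg_right h₃ (abs_nonneg (u t))]
  have hus : |u s| ≤ 1 / 4 * M := by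
    have := (hy z (hsub hz) s (hsub (hball hs))).2
    rw [huz, zero_add] at this
    rw [this]
    refine hest _ fun t ht => ?_
    have h₁ : |-(Q t) ^ 2 * y t - Q t * u t| ≤ |Q t| ^ 2 * |y t| + |Q t| * |u t| := by
      rw [← abs_mul, ← abs_pow, ← abs_mul, ← abs_neg (Q t ^ 2 * y t), ← neg_mul]
      exact abs_sub _ _
    refine h₁.trans (le_trans ?_ (mul_le_mul_of_nonneg_left (hmaxM t ht) (by positivity)))
    rw [← sq_abs (Q t)]
    have h₂ : |Q t| ≤ 2 + 2 * |Q t| ^ 2 := by nlinarith [sq_nonneg (|Q t| - 1)]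
    have h₃ : |Q t| ^ 2 ≤ 2 + 2 * |Q t| ^ 2 := by nlinarith [sq_nonneg (|Q t|)]
    nlinarith [mul_le_mul_of_nonneg_right h₃ (abs_nonneg (y t)),
      mul_le_mul_of_nonneg_right h₂ (abs_nonneg (u t))]
  have hw0 := hmaxM w right_mem_uIcc
  have hyw := abs_nonneg (y w)
  have huw := abs_nonneg (u w)
  exact ⟨abs_eq_zero.mp (by linarith), abs_eq_zero.mp (by linarith)⟩

/-- A solution with vanishing Cauchy data vanishes on the whole interval. -/
theorem SolvesWithOn.eq_zero {I : Set ℝ} (hIo : IsOpen I) (hIc : I.OrdConnected)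
    {Q y u : ℝ → ℝ} (hQ : LocL2On I Q) (hy : SolvesWithOn I Q y u) {p : ℝ} (hp : p ∈ I)
    (hyp : y p = 0) (hup : u p = 0) : ∀ x ∈ I, y x = 0 := by
  have hsub : I ⊆ {x | x ∈ I ∧ y x = 0 ∧ u x = 0} := by
    refine hIc.isPreconnected.subset_of_closure_inter_subset ?_ ⟨p, hp, hp, hyp, hup⟩ ?_
    · refine Metric.isOpen_iff.mpr fun x ⟨hx, hyx, hux⟩ => ?_
      obtain ⟨ε, hε, hball, h⟩ := hy.exists_ball_eq_zero hIo hIc hQ hx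
      exact ⟨ε, hε, fun w hw => ⟨hball hw, h x (Metric.mem_ball_self hε) w hw hyx hux⟩⟩
    · rintro x ⟨hxcl, hx⟩
      obtain ⟨ε, hε, -, h⟩ := hy.exists_ball_eq_zero hIo hIc hQ hx
      obtain ⟨z, ⟨-, hyz, huz⟩, hzx⟩ := Metric.mem_closure_iff.mp hxcl ε hε
      rw [dist_comm] at hzx
      exact ⟨hx, h z hzx x (Metric.mem_ball_self hε) hyz huz⟩
  exact fun x hx => (hsub hx).2.1

/-- Near a zero `p` with `u p ≠ 0`, the solution is comparable to its linearization
`u p * (x - p)`. -/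
theorem SolvesWithOn.exists_ball_abs_sub_lt {I : Set ℝ} (hIo : IsOpen I) (hIc : I.OrdConnected)
    {Q y u : ℝ → ℝ} (hQ : LocL2On I Q) (hy : SolvesWithOn I Q y u) {p : ℝ} (hp : p ∈ I)
    (hyp : y p = 0) (hup : u p ≠ 0) :
    ∃ ε > 0, ∀ x, |x - p| < ε → x ≠ p → |y x - u p * (x - p)| < |u p| * |x - p| := by
  have hyc := hy.continuousOn_fst hIo hIc
  have huc := hy.continuousOn_snd hIo hIc
  have hup0 : 0 < |u p| := abs_pos.mpr hup
  obtain ⟨ε₁, hε₁, hsub₁, hsmall⟩ := exists_ball_abs_integral_le hIo hIc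
    (fun a ha b hb => hQ.intervalIntegrable_bound ha hb) hp (η := 1 / 8) (by norm_num)
  obtain ⟨ε₂, hε₂, hu₂⟩ :=
    Metric.continuousAt_iff.mp (huc.continuousAt (hIo.mem_nhds hp)) (|u p| / 2) (by positivity)
  refine ⟨min ε₁ ε₂, lt_min hε₁ hε₂, fun x hx hxp => ?_⟩
  have hx₁ : x ∈ Metric.ball p ε₁ := lt_of_lt_of_le hx (min_le_left _ _)
  have hp₁ : p ∈ Metric.ball p ε₁ := Metric.mem_ball_self hε₁
  have hball : uIcc p x ⊆ Metric.ball p ε₁ := by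
    rw [Real.ball_eq_Ioo] at hp₁ hx₁ ⊢
    exact ordConnected_Ioo.uIcc_subset hp₁ hx₁
  have hdist : ∀ t ∈ uIcc p x, |t - p| ≤ |x - p| := fun t ht => abs_sub_left_of_mem_uIcc ht
  obtain ⟨s, hs, hmax⟩ := isCompact_uIcc.exists_isMaxOn nonempty_uIcc
    (hyc.abs.mono (hball.trans hsub₁))
  set M := |y s| with hM
  have hmaxM : ∀ t ∈ uIcc p x, |y t| ≤ M := fun t ht => hmax ht
  have hM0 : 0 ≤ M := abs_nonneg _
  have hest : ∀ z ∈ uIcc p x, |y z - u p * (z - p)| ≤ 1 / 8 * M + |u p| / 2 * |x - p| := by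
    intro z hz
    have hzI : z ∈ I := hsub₁ (hball hz)
    have hpz : uIcc p z ⊆ uIcc p x := uIcc_subset_uIcc_left hz
    have hpzI : uIcc p z ⊆ I := hpz.trans (hball.trans hsub₁)
    have hFi : IntervalIntegrable (fun t => Q t * y t + u t) volume p z :=
      ((hQ.intervalIntegrable hp hzI).mul_continuousOn (hyc.mono hpzI)).add
        (huc.mono hpzI).intervalIntegrable
    have heq : y z - u p * (z - p) = ∫ t in p..z, ((Q t * y t + u t) - u p) := by
      rw [integral_sub hFi intervalIntegrable_const, intervalIntegral.integral_const,
        (hy p hp z hzI).1, hyp, smul_eq_mul]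
      ring
    have hki := (hQ.intervalIntegrable_bound hp hzI).mul_const M
    have h₁ := norm_integral_le_abs_of_norm_le (μ := volume) (a := p) (b := z)
      (f := fun t => (Q t * y t + u t) - u p)
      (g := fun t => (2 + 2 * Q t ^ 2) * M + |u p| / 2)
      ((ae_restrict_iff' measurableSet_uIoc).mpr (Eventually.of_forall fun t ht => by
        have ht' := hpz (uIoc_subset_uIcc ht)
        have hut : |u t - u p| < |u p| / 2 :=
          hu₂ (lt_of_le_of_lt (hdist t ht') (lt_of_lt_of_le hx (min_le_right _ _)))
        have hQt : |Q t| ≤ 2 + 2 * Q t ^ 2 := by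
          rw [← sq_abs (Q t)]; nlinarith [sq_nonneg (|Q t| - 1)]
        have hQy : |Q t * y t| ≤ (2 + 2 * Q t ^ 2) * M := by
          rw [abs_mul]
          exact mul_le_mul hQt (hmaxM t ht') (abs_nonneg _) (by positivity)
        rw [Real.norm_eq_abs, add_sub_assoc]
        exact (abs_add_le _ _).trans (add_le_add hQy hut.le)))
      (hki.add intervalIntegrable_const)
    rw [integral_add hki intervalIntegrable_const, intervalIntegral.integral_mul_const,
      intervalIntegral.integral_const, ← heq, Real.norm_eq_abs, smul_eq_mul] at h₁
    refine h₁.trans ((abs_add_le _ _).trans ?_)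
    rw [abs_mul, abs_mul, abs_of_nonneg hM0, abs_of_nonneg (by positivity : 0 ≤ |u p| / 2),
      mul_comm |z - p|]
    exact add_le_add (mul_le_mul_of_nonneg_right (hsmall p hp₁ z (hball hz)) hM0)
      (mul_le_mul_of_nonneg_left (hdist z hz) (by positivity))
  have hxp0 : 0 < |u p| * |x - p| := mul_pos hup0 (abs_pos.mpr (sub_ne_zero.mpr hxp))
  have hMle : M ≤ 1 / 8 * M + |u p| / 2 * |x - p| + |u p| * |x - p| := by
    have h₁ := abs_sub_abs_le_abs_sub (y s) (u p * (s - p))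
    have h₂ : |u p * (s - p)| ≤ |u p| * |x - p| := by
      rw [abs_mul]
      exact mul_le_mul_of_nonneg_left (hdist s hs) hup0.le
    linarith [hest s hs]
  linarith [hest x right_mem_uIcc]

/-- **Lemma (trichotomy at a zero).** Let `I` be an open interval, `Q ∈ L²_loc(I)`, `q = Q'`,
and `y` a solution of `L_q y = 0` on `I` (system sense, with `u = y' - Q y`). If `y x₀ = 0`
for some `x₀ ∈ I`, then:
(i) if `u x₀ = 0` then `y ≡ 0` on `I`;
(ii) if `u x₀ > 0` then near `x₀`, `y < 0` to the left and `y > 0` to the right of `x₀`;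
(iii) if `u x₀ < 0` then near `x₀`, `y > 0` to the left and `y < 0` to the right of `x₀`.
In particular, if `y` is not identically zero on `I`, then all its zeros in `I` are isolated. -/
theorem zero_trichotomy (I : Set ℝ) (hIo : IsOpen I) (hIc : I.OrdConnected)
    (Q : ℝ → ℝ) (hQ : LocL2On I Q) (y u : ℝ → ℝ) (hy : SolvesWithOn I Q y u)
    (x₀ : ℝ) (hx₀ : x₀ ∈ I) (hy0 : y x₀ = 0) :
    (u x₀ = 0 → ∀ x ∈ I, y x = 0) ∧
    (0 < u x₀ → ∃ δ > 0,
      (∀ x ∈ I, x₀ - δ < x → x < x₀ → y x < 0) ∧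
      (∀ x ∈ I, x₀ < x → x < x₀ + δ → 0 < y x)) ∧
    (u x₀ < 0 → ∃ δ > 0,
      (∀ x ∈ I, x₀ - δ < x → x < x₀ → 0 < y x) ∧
      (∀ x ∈ I, x₀ < x → x < x₀ + δ → y x < 0)) ∧
    ((¬ ∀ x ∈ I, y x = 0) → ∀ z ∈ I, y z = 0 →
      ∃ δ > 0, ∀ w ∈ I, w ≠ z → |w - z| < δ → y w ≠ 0) := by
  refine ⟨fun hu0 => hy.eq_zero hIo hIc hQ hx₀ hy0 hu0, fun hu0 => ?_, fun hu0 => ?_,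
    fun hne z hz hyz => ?_⟩
  · obtain ⟨δ, hδ, h⟩ := hy.exists_ball_abs_sub_lt hIo hIc hQ hx₀ hy0 hu0.ne'
    refine ⟨δ, hδ, fun x _ h₁ h₂ => ?_, fun x _ h₁ h₂ => ?_⟩
    · have hx := h x (abs_lt.mpr ⟨by linarith, by linarith⟩) h₂.ne
      rw [abs_of_pos hu0, abs_of_neg (sub_neg.mpr h₂)] at hx
      linarith [(abs_lt.mp hx).2]
    · have hx := h x (abs_lt.mpr ⟨by linarith, by linarith⟩) h₁.ne'
      rw [abs_of_pos hu0, abs_of_pos (sub_pos.mpr h₁)] at hx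
      linarith [(abs_lt.mp hx).1]
  · obtain ⟨δ, hδ, h⟩ := hy.exists_ball_abs_sub_lt hIo hIc hQ hx₀ hy0 hu0.ne
    refine ⟨δ, hδ, fun x _ h₁ h₂ => ?_, fun x _ h₁ h₂ => ?_⟩
    · have hx := h x (abs_lt.mpr ⟨by linarith, by linarith⟩) h₂.ne
      rw [abs_of_neg hu0, abs_of_neg (sub_neg.mpr h₂)] at hx
      linarith [(abs_lt.mp hx).1]
    · have hx := h x (abs_lt.mpr ⟨by linarith, by linarith⟩) h₁.ne'
      rw [abs_of_neg hu0, abs_of_pos (sub_pos.mpr h₁)] at hx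
      linarith [(abs_lt.mp hx).2]
  · have huz : u z ≠ 0 := fun huz => hne (hy.eq_zero hIo hIc hQ hz hyz huz)
    obtain ⟨δ, hδ, h⟩ := hy.exists_ball_abs_sub_lt hIo hIc hQ hz hyz huz
    refine ⟨δ, hδ, fun w _ hwz hw hyw => ?_⟩
    have := h w hw hwz
    rw [hyw, zero_sub, abs_neg, abs_mul] at this
    exact lt_irrefl _ this
end
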